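/- arXiv:2602.14220 — 2 statements merged into one kernel-verified Lean document; each statement's English description precedes it below -/
import Mathlib

section
/- Let N ≥ 1 and let 𝒥 be a nonzero N×N real matrix. Let S be the set of skew-symmetric invertible real matrices B̄ indexed by Unit ⊕ Fin N whose associated 2-form ω(x,y) = x ⬝ᵥ B̄.mulVec y is closed for the almost abelian bracket determined by 𝒥. Call B̄, B̄' ∈ S equivalent if there exist a real number c ≠ 0 and an invertible matrix M indexed by Unit ⊕ Fin N satisfying M.mulVec [x,y] = [M.mulVec x, M.mulVec y] for all x, y, such that B̄' = c • (Mᵀ * B̄ * M). Then there exists a finite subset F of S such that every element of S is equivalent to some element of F; in other words, the moduli space of symplectic forms on the almost abelian Lie algebra determined by 𝒥 is finite. -/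
open Matrix

noncomputable section

/-- The matrix `𝒥̄` on `Unit ⊕ Fin N` with lower-right block `𝒥` and zeros elsewhere. -/
def jbar {N : ℕ} (J : Matrix (Fin N) (Fin N) ℝ) :
    Matrix (Unit ⊕ Fin N) (Unit ⊕ Fin N) ℝ :=
  Matrix.fromBlocks 0 0 0 J

/-- The almost abelian Lie bracket determined by `𝒥`. -/
def aaBracket {N : ℕ} (J : Matrix (Fin N) (Fin N) ℝ)
    (x y : (Unit ⊕ Fin N) → ℝ) : (Unit ⊕ Fin N) → ℝ :=
  x (Sum.inl ()) • (jbar J).mulVec y - y (Sum.inl ()) • (jbar J).mulVec x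

/-- The 2-form associated to a matrix `B̄`. -/
def twoForm {N : ℕ} (B : Matrix (Unit ⊕ Fin N) (Unit ⊕ Fin N) ℝ)
    (x y : (Unit ⊕ Fin N) → ℝ) : ℝ :=
  x ⬝ᵥ B.mulVec y

/-- Closedness of the 2-form associated to `B̄` for the almost abelian bracket of `𝒥`. -/
def IsClosed2Form {N : ℕ} (J : Matrix (Fin N) (Fin N) ℝ)
    (B : Matrix (Unit ⊕ Fin N) (Unit ⊕ Fin N) ℝ) : Prop :=
  ∀ x y z : (Unit ⊕ Fin N) → ℝ,
    twoForm B x (aaBracket J y z) + twoForm B z (aaBracket J x y)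
      + twoForm B y (aaBracket J z x) = 0

open Polynomial in
theorem sqrt_lift (P A s : ℝ[X]) (hP : Irreducible P) (hs : P ∣ s ^ 2 - A) (hA : ¬ P ∣ A)
    (k : ℕ) : ∃ s : ℝ[X], P ^ (k + 1) ∣ s ^ 2 - A := by
  induction k with
  | zero => exact ⟨s, by simpa using hs⟩
  | succ k ih =>
    obtain ⟨s, w, hw⟩ := ih
    have hsP : ¬ P ∣ s := by
      intro h
      apply hA
      have h1 : P ∣ s ^ 2 - A := by
        rw [hw]
        exact Dvd.dvd.mul_right (dvd_pow_self _ (by omega)) _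
      have h2 : P ∣ s ^ 2 := dvd_pow h (by norm_num)
      have := dvd_sub h2 h1
      simpa using this
    have h2s : ¬ P ∣ 2 * s := by
      intro h
      apply hsP
      have : s = C (1/2 : ℝ) * (2 * s) := by
        have : (2 : ℝ[X]) = C 2 := rfl
        rw [this, ← mul_assoc, ← C_mul]; norm_num
      rw [this]
      exact Dvd.dvd.mul_left h _
    obtain ⟨a, b, hab⟩ := (hP.coprime_iff_not_dvd).2 h2s
    refine ⟨s - w * b * P ^ (k + 1), a * w + w ^ 2 * b ^ 2 * P ^ k, ?_⟩
    have : (s - w * b * P ^ (k + 1)) ^ 2 - A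
      = (s ^ 2 - A) - 2 * s * w * b * P ^ (k+1) + w ^ 2 * b ^ 2 * P ^ (2 * k + 2) := by ring
    rw [this, hw]
    have : (P ^ (k+1) * w) = (P ^ (k+1) * w) * (a * P + b * (2 * s)) := by rw [hab, mul_one]
    rw [this]; ring

open Polynomial in
theorem sqrt_base (P : ℝ[X]) (hP : Irreducible P) (hm : P.Monic) :
    ∃ σ : ℝ, (σ = 1 ∨ σ = -1) ∧ ∃ s : ℝ[X], P ∣ s ^ 2 - C σ * X := by
  have hd := hP.natDegree_le_two
  have hpos := hP.natDegree_pos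
  by_cases h1 : ∃ r, P.IsRoot r
  · obtain ⟨r, hr⟩ := h1
    have hdv : X - C r ∣ P := dvd_iff_isRoot.2 hr
    have hass : Associated (X - C r) P :=
      (irreducible_X_sub_C r).associated_of_dvd hP hdv
    have key : ∀ Q : ℝ[X], Q.eval r = 0 → P ∣ Q := fun Q hQ =>
      hass.symm.dvd.trans (dvd_iff_isRoot.2 hQ)
    rcases le_total 0 r with h | h
    · refine ⟨1, Or.inl rfl, C (Real.sqrt r), key _ ?_⟩
      simp [Real.sq_sqrt h]
    · refine ⟨-1, Or.inr rfl, C (Real.sqrt (-r)), key _ ?_⟩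
      have : 0 ≤ -r := by linarith
      simp [Real.sq_sqrt this]
  · have h2 : P.natDegree = 2 := by
      rcases Nat.lt_or_ge P.natDegree 2 with h | h
      · exfalso
        have h3 : P.natDegree = 1 := by omega
        apply h1
        obtain ⟨x, hx⟩ := exists_root_of_degree_eq_one (degree_eq_iff_natDegree_eq_of_pos (by norm_num) |>.2 h3)
        exact ⟨x, hx⟩
      · omega
    have hPe : P = X ^ 2 + C (P.coeff 1) * X + C (P.coeff 0) := by
      conv_lhs => rw [P.as_sum_range_C_mul_X_pow, h2]
      have : P.coeff 2 = 1 := by rw [← h2]; exact hm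
      simp [Finset.sum_range_succ, this]; ring
    set t := P.coeff 1
    set δ := P.coeff 0
    have hdisc : t ^ 2 < 4 * δ := by
      by_contra hc
      push Not at hc
      apply h1
      refine ⟨(-t + Real.sqrt (t ^ 2 - 4 * δ)) / 2, ?_⟩
      have hs := Real.sq_sqrt (show 0 ≤ t ^ 2 - 4 * δ by linarith)
      rw [IsRoot, hPe]
      simp
      nlinarith
    have hδ : 0 < δ := by nlinarith [sq_nonneg t]
    have hsq := Real.sq_sqrt hδ.le
    set w := Real.sqrt δ
    have hw : 0 < w := Real.sqrt_pos.2 hδ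
    have hpos : 0 < 2 * w - t := by
      have := abs_lt_of_sq_lt_sq (a := t) (b := 2 * w) (by nlinarith) (by linarith)
      have := abs_lt.1 (this)
      linarith
    set b := 1 / Real.sqrt (2 * w - t)
    have hb : b ^ 2 * (2 * w - t) = 1 := by
      simp only [b]
      rw [div_pow, Real.sq_sqrt hpos.le]
      field_simp
    refine ⟨1, Or.inl rfl, C (b * w) + C b * X, C (b ^ 2), ?_⟩
    rw [hPe]
    have e1 : (C (b * w) + C b * X) ^ 2 - C 1 * X
       = C (b^2) * X ^ 2 + C (2 * b ^ 2 * w - 1) * X + C (b ^ 2 * w ^ 2) := by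
      simp only [map_mul, map_pow, map_sub, map_ofNat, map_one]; ring
    rw [e1]
    have e2 : 2 * b ^ 2 * w - 1 = t * b ^ 2 := by linarith
    rw [e2, hsq]
    simp only [map_mul, map_pow]; ring

open Polynomial in
theorem sqrt_poly (P : ℝ[X]) (hP : Irreducible P) (hm : P.Monic) (hX : ¬ P ∣ X) (k : ℕ) :
    ∃ σ : ℝ, (σ = 1 ∨ σ = -1) ∧ ∃ s : ℝ[X], P ^ k ∣ s ^ 2 - C σ * X := by
  obtain ⟨σ, hσ, s, hs⟩ := sqrt_base P hP hm
  obtain ⟨s', hs'⟩ := sqrt_lift P (C σ * X) s hP hs (by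
    intro h
    apply hX
    have : X = C σ * (C σ * X) := by
      rw [← mul_assoc, ← C_mul]
      rcases hσ with rfl | rfl <;> norm_num
    rw [this]
    exact Dvd.dvd.mul_left h _) k
  exact ⟨σ, hσ, s', (pow_dvd_pow _ (by omega)).trans hs'⟩

section aa
variable {V : Type*} [AddCommGroup V] [Module ℝ V]

theorem aeval_mul_app (J : V →ₗ[ℝ] V) (f g : Polynomial ℝ) (x : V) :
    Polynomial.aeval J (f * g) x = Polynomial.aeval J f (Polynomial.aeval J g x) := by
  rw [map_mul]; rfl

theorem aeval_comm_app (J d : V →ₗ[ℝ] V) (h : ∀ x, d (J x) = J (d x)) (f : Polynomial ℝ) (x : V) :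
    d (Polynomial.aeval J f x) = Polynomial.aeval J f (d x) := by
  induction f using Polynomial.induction_on' generalizing x with
  | add p q hp hq => simp [hp, hq]
  | monomial n a =>
    simp only [Polynomial.aeval_monomial, Module.algebraMap_end_eq_smul_id, Module.End.mul_apply, 
      LinearMap.smul_apply, LinearMap.id_apply, map_smul]
    congr 1
    induction n generalizing x with
    | zero => rfl
    | succ n ih => rw [pow_succ, Module.End.mul_apply, ih, h]; rfl

theorem aeval_intertwine {V' : Type*} [AddCommGroup V'] [Module ℝ V'] (J : V →ₗ[ℝ] V)
    (J' : V' →ₗ[ℝ] V') (e : V →ₗ[ℝ] V')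
    (h : ∀ x, e (J x) = J' (e x)) (f : Polynomial ℝ) (x : V) :
    e (Polynomial.aeval J f x) = Polynomial.aeval J' f (e x) := by
  induction f using Polynomial.induction_on' generalizing x with
  | add p q hp hq => simp [hp, hq]
  | monomial n a =>
    simp only [Polynomial.aeval_monomial, Module.algebraMap_end_eq_smul_id, Module.End.mul_apply, 
      LinearMap.smul_apply, LinearMap.id_apply, map_smul]
    congr 1
    induction n generalizing x with
    | zero => rfl
    | succ n ih => rw [pow_succ, Module.End.mul_apply, ih, h]; rfl

theorem aeval_eig (J : V →ₗ[ℝ] V) (l : ℝ) (v : V) (h : J v = l • v) (f : Polynomial ℝ) :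
    Polynomial.aeval J f v = f.eval l • v := by
  induction f using Polynomial.induction_on' with
  | add p q hp hq => simp [hp, hq, add_smul]
  | monomial n a =>
    simp only [Polynomial.aeval_monomial, Module.algebraMap_end_eq_smul_id, Module.End.mul_apply, 
      LinearMap.smul_apply, LinearMap.id_apply, Polynomial.eval_monomial, mul_smul]
    congr 1
    induction n with
    | zero => simp
    | succ n ih => rw [pow_succ, Module.End.mul_apply, h, map_smul, ih, smul_smul, pow_succ, mul_comm]

theorem aeval_adj (J : V →ₗ[ℝ] V) (B : V →ₗ[ℝ] V →ₗ[ℝ] ℝ)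
    (h : ∀ x y, B (J x) y = - B x (J y)) (f : Polynomial ℝ) (x y : V) :
    B (Polynomial.aeval J f x) y = B x (Polynomial.aeval J (f.comp (-Polynomial.X)) y) := by
  induction f using Polynomial.induction_on' with
  | add p q hp hq => simp [hp, hq]
  | monomial n a =>
    rw [← Polynomial.C_mul_X_pow_eq_monomial]
    simp only [Polynomial.mul_comp, Polynomial.C_comp, Polynomial.pow_comp, Polynomial.X_comp]
    simp only [aeval_mul_app, Polynomial.aeval_C, Module.algebraMap_end_apply, map_smul,
      LinearMap.smul_apply]
    congr 1
    simp only [map_pow, map_neg, Polynomial.aeval_X]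
    induction n generalizing x with
    | zero => simp
    | succ n ih =>
      rw [pow_succ, pow_succ', Module.End.mul_apply, ih, h]; simp

theorem aeval_selfadj (d : V →ₗ[ℝ] V) (B : V →ₗ[ℝ] V →ₗ[ℝ] ℝ)
    (h : ∀ x y, B (d x) y = B x (d y)) (f : Polynomial ℝ) (x y : V) :
    B (Polynomial.aeval d f x) y = B x (Polynomial.aeval d f y) := by
  induction f using Polynomial.induction_on' with
  | add p q hp hq => simp [hp, hq]
  | monomial n a =>
    simp only [Polynomial.aeval_monomial, Module.algebraMap_end_eq_smul_id, Module.End.mul_apply, 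
      LinearMap.smul_apply, LinearMap.id_apply, map_smul]
    congr 1
    induction n generalizing x with
    | zero => simp
    | succ n ih =>
      rw [pow_succ, Module.End.mul_apply, ih, h, ← Module.End.mul_apply, ← pow_succ', pow_succ]

/-- Socle lemma. -/
theorem socle (J : V →ₗ[ℝ] V) (p : Polynomial ℝ) (hp : Irreducible p) (h : ℕ) (x : V)
    (f : Polynomial ℝ) (hx : Polynomial.aeval J (p ^ (h + 1)) x = 0) (hf : ¬ p ^ (h + 1) ∣ f) :
    ∃ r : Polynomial ℝ, Polynomial.aeval J r (Polynomial.aeval J f x) = Polynomial.aeval J (p ^ h) x := by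
  obtain ⟨j, hj, hass⟩ := (dvd_prime_pow hp.prime _).1 (EuclideanDomain.gcd_dvd_right f (p ^ (h + 1)))
  have hjh : j ≤ h := by
    by_contra hc
    have : j = h + 1 := by omega
    subst this
    exact hf (hass.symm.dvd.trans (EuclideanDomain.gcd_dvd_left _ _))
  obtain ⟨c, hc⟩ := hass.dvd
  have hb := EuclideanDomain.gcd_eq_gcd_ab f (p ^ (h + 1))
  set s := EuclideanDomain.gcdA f (p ^ (h + 1))
  set t := EuclideanDomain.gcdB f (p ^ (h + 1))
  refine ⟨p ^ (h - j) * c * s, ?_⟩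
  rw [← aeval_mul_app]
  have : p ^ h = p ^ (h - j) * c * s * f + (p ^ (h - j) * c * t) * p ^ (h + 1) := by
    have : p ^ h = p ^ (h - j) * p ^ j := by rw [← pow_add]; congr 1; omega
    rw [this, hc, hb]; ring
  rw [this, map_add, LinearMap.add_apply, aeval_mul_app J _ (p ^ (h+1)), hx]
  simp

theorem ann_pow (J : V →ₗ[ℝ] V) (p : Polynomial ℝ) (hp : Irreducible p) (h : ℕ) (x : V)
    (f : Polynomial ℝ) (hx : Polynomial.aeval J (p ^ (h + 1)) x = 0) 
    (hx' : Polynomial.aeval J (p ^ h) x ≠ 0)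
    (hf : Polynomial.aeval J f x = 0) : p ^ (h + 1) ∣ f := by
  by_contra hc
  obtain ⟨r, hr⟩ := socle J p hp h x f hx hc
  rw [hf, map_zero] at hr
  exact hx' hr.symm

/-- cyclic submodule -/
def cyc (J : V →ₗ[ℝ] V) (x : V) : Submodule ℝ V :=
  LinearMap.range ((LinearMap.applyₗ x) ∘ₗ (Polynomial.aeval J).toLinearMap)

theorem mem_cyc (J : V →ₗ[ℝ] V) (x w : V) : w ∈ cyc J x ↔ ∃ f : Polynomial ℝ, Polynomial.aeval J f x = w := by
  simp [cyc]

theorem cyc_stable (J : V →ₗ[ℝ] V) (x w : V) (f : Polynomial ℝ) (h : w ∈ cyc J x) :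
    Polynomial.aeval J f w ∈ cyc J x := by
  rw [mem_cyc] at *
  obtain ⟨g, rfl⟩ := h
  exact ⟨f * g, aeval_mul_app _ _ _ _⟩

theorem cyc_self (J : V →ₗ[ℝ] V) (x : V) : x ∈ cyc J x := (mem_cyc _ _ _).2 ⟨1, by simp⟩

end aa
/-- A space with endomorphism, bilinear form and vector. -/
structure Str : Type 1 where
  V : Type
  [acg : AddCommGroup V]
  [mod : Module ℝ V]
  [fd : FiniteDimensional ℝ V]
  J : V →ₗ[ℝ] V
  B : V →ₗ[ℝ] V →ₗ[ℝ] ℝ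
  v : V

attribute [instance] Str.acg Str.mod Str.fd

/-- Isomorphism of structures. -/
def SIso (S T : Str) : Prop :=
  ∃ e : S.V ≃ₗ[ℝ] T.V, (∀ x, e (S.J x) = T.J (e x)) ∧
    (∀ x y, T.B (e x) (e y) = S.B x y) ∧ ∃ a : ℝ, a ≠ 0 ∧ e S.v = a • T.v

theorem SIso.symm {S T : Str} (h : SIso S T) : SIso T S := by
  obtain ⟨e, h1, h2, a, ha, h3⟩ := h
  refine ⟨e.symm, fun x => ?_, fun x y => ?_, a⁻¹, inv_ne_zero ha, ?_⟩
  · rw [LinearEquiv.symm_apply_eq, h1]; simp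
  · rw [← h2]; simp
  · rw [LinearEquiv.symm_apply_eq, map_smul, h3, smul_smul, inv_mul_cancel₀ ha, one_smul]

theorem SIso.trans {S T U : Str} (h : SIso S T) (h' : SIso T U) : SIso S U := by
  obtain ⟨e, h1, h2, a, ha, h3⟩ := h
  obtain ⟨e', h1', h2', a', ha', h3'⟩ := h'
  refine ⟨e.trans e', fun x => ?_, fun x y => ?_, a * a', mul_ne_zero ha ha', ?_⟩
  · simp [h1, h1']
  · simp [h2, h2']
  · simp [h3, h3', smul_smul]

/-- Symplectic structures with `q(J)=0` and eigenvector (or zero) `v`. -/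
structure SGood (q : Polynomial ℝ) (S : Str) : Prop where
  ann : Polynomial.aeval S.J q = 0
  alt : ∀ x, S.B x x = 0
  nd : ∀ x, (∀ y, S.B x y = 0) → x = 0
  sk : ∀ x y, S.B (S.J x) y = - S.B x (S.J y)
  eig : ∃ l : ℝ, S.J S.v = l • S.v

theorem alt_neg {V : Type*} [AddCommGroup V] [Module ℝ V] (B : V →ₗ[ℝ] V →ₗ[ℝ] ℝ)
    (h : ∀ x, B x x = 0) (x y : V) : B x y = - B y x := by
  have := h (x + y)
  simp [h] at this
  linarith

/-- Orthogonal sum; the vector of the second summand is ignored. -/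
def ssum (S T : Str) : Str where
  V := S.V × T.V
  J := S.J.prodMap T.J
  B := S.B.compl₁₂ (LinearMap.fst ℝ S.V T.V) (LinearMap.fst ℝ S.V T.V)
    + T.B.compl₁₂ (LinearMap.snd ℝ S.V T.V) (LinearMap.snd ℝ S.V T.V)
  v := (S.v, 0)

/-- Change the sign of the form. -/
def sneg (S : Str) : Str where
  V := S.V
  J := S.J
  B := - S.B
  v := S.v

theorem ssum_congr {S T S' T' : Str} (h : SIso S S') (h' : SIso T T') :
    SIso (ssum S T) (ssum S' T') := by
  obtain ⟨e, h1, h2, a, ha, h3⟩ := h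
  obtain ⟨e', h1', h2', a', ha', h3'⟩ := h'
  refine ⟨LinearEquiv.prodCongr e e', fun x => ?_, fun x y => ?_, a, ha, ?_⟩
  · exact Prod.ext (h1 x.1) (h1' x.2)
  · exact congrArg₂ (· + ·) (h2 x.1 y.1) (h2' x.2 y.2)
  · exact Prod.ext h3 ((map_zero e').trans (smul_zero a).symm)

/-- Finitely many isomorphism classes. -/
def FinIso (F : Str → Prop) : Prop :=
  ∃ L : Set Str, L.Finite ∧ ∀ S, F S → ∃ T ∈ L, SIso S T

/-- Restriction to a stable subspace. -/
def srestr (S : Str) (W : Submodule ℝ S.V) (h : ∀ x ∈ W, S.J x ∈ W) (w : W) : Str where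
  V := W
  J := S.J.restrict h
  B := S.B.compl₁₂ W.subtype W.subtype
  v := w

/-- Indecomposable structures. -/
def SIndec (S : Str) : Prop :=
  ∀ W W' : Submodule ℝ S.V, IsCompl W W' → (∀ x ∈ W, S.J x ∈ W) → (∀ x ∈ W', S.J x ∈ W') →
    (∀ x ∈ W, ∀ y ∈ W', S.B x y = 0) → S.v ∈ W → W = ⊥ ∨ W' = ⊥

theorem srestr_good (q : Polynomial ℝ) (S : Str) (hS : SGood q S) (W W' : Submodule ℝ S.V)
    (hc : IsCompl W W') (h : ∀ x ∈ W, S.J x ∈ W)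
    (ho : ∀ x ∈ W, ∀ y ∈ W', S.B x y = 0) (w : W) (hw : ∃ l : ℝ, S.J w = l • (w : S.V)) :
    SGood q (srestr S W h w) where
  ann := by
    apply LinearMap.ext
    intro x
    apply Subtype.ext
    have := aeval_intertwine (S.J.restrict h) S.J W.subtype (fun x => rfl) q x
    change W.subtype (Polynomial.aeval (S.J.restrict h) q x) = 0
    rw [this, hS.ann]; rfl
  alt := fun x => hS.alt _
  nd := fun x hx => by
    apply Subtype.ext
    apply hS.nd
    intro y
    have hy : y ∈ W ⊔ W' := by rw [hc.sup_eq_top]; trivial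
    obtain ⟨a, ha, b, hb, rfl⟩ := Submodule.mem_sup.1 hy
    rw [map_add, ho _ x.2 b hb, add_zero]
    exact hx ⟨a, ha⟩
  sk := fun x y => hS.sk _ _
  eig := by
    obtain ⟨l, hl⟩ := hw
    exact ⟨l, Subtype.ext hl⟩

theorem decomp (q : Polynomial ℝ) (S : Str) (hS : SGood q S) (hI : ¬ SIndec S) :
    ∃ S₁ S₂ : Str, SGood q S₁ ∧ SGood q S₂ ∧
      Module.finrank ℝ S₁.V < Module.finrank ℝ S.V ∧
      Module.finrank ℝ S₂.V < Module.finrank ℝ S.V ∧ SIso S (ssum S₁ S₂) := by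
  unfold SIndec at hI
  push Not at hI
  obtain ⟨W, W', hc, h1, h2, ho, hv, hW, hW'⟩ := hI
  have ho' : ∀ x ∈ W', ∀ y ∈ W, S.B x y = 0 := fun x hx y hy => by
    rw [alt_neg _ hS.alt, ho y hy x hx, neg_zero]
  refine ⟨srestr S W h1 ⟨S.v, hv⟩, srestr S W' h2 0, srestr_good q S hS W W' hc h1 ho _ hS.eig,
    srestr_good q S hS W' W hc.symm h2 ho' _ ⟨0, by simp⟩, ?_, ?_, ?_⟩
  · apply Submodule.finrank_lt
    intro h
    apply hW'
    have := hc.inf_eq_bot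
    simpa [h] using this
  · apply Submodule.finrank_lt
    intro h
    apply hW
    have := hc.inf_eq_bot
    simpa [h] using this
  · apply SIso.symm
    refine ⟨Submodule.prodEquivOfIsCompl W W' hc, ?_, ?_, 1, one_ne_zero, ?_⟩
    · rintro ⟨x, y⟩
      change S.J x.1 + S.J y.1 = S.J (x.1 + y.1)
      rw [map_add]
    · rintro ⟨x, y⟩ ⟨x', y'⟩
      change S.B (x.1 + y.1) (x'.1 + y'.1) = S.B x.1 x'.1 + S.B y.1 y'.1
      simp only [map_add, LinearMap.add_apply, ho _ x.2 _ y'.2, ho' _ y.2 _ x'.2]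
      ring
    · change S.v + (0 : S.V) = (1 : ℝ) • S.v
      simp

theorem indec_top (q : Polynomial ℝ) (S : Str) (hS : SGood q S) (hI : SIndec S)
    (C : Submodule ℝ S.V) (hJ : ∀ x ∈ C, S.J x ∈ C) (hv : S.v ∈ C) (h0 : C ≠ ⊥)
    (hnd : ∀ w ∈ C, (∀ c ∈ C, S.B w c = 0) → w = 0) : C = ⊤ := by
  have hr : LinearMap.BilinForm.IsRefl S.B := fun x y h => by
    rw [alt_neg _ hS.alt, h, neg_zero]
  have hc : IsCompl C (LinearMap.BilinForm.orthogonal S.B C) := by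
    apply LinearMap.BilinForm.isCompl_orthogonal_of_restrict_nondegenerate hr
    constructor
    · intro x hx
      exact Subtype.ext (hnd x x.2 fun c hc => hx ⟨c, hc⟩)
    · intro x hx
      exact Subtype.ext (hnd x x.2 fun c hc => hr _ _ (hx ⟨c, hc⟩))
  have g1 : ∀ x ∈ LinearMap.BilinForm.orthogonal S.B C,
      S.J x ∈ LinearMap.BilinForm.orthogonal S.B C := by
    intro x hx y hy
    have := hx (S.J y) (hJ y hy)
    change S.B y (S.J x) = 0
    change S.B (S.J y) x = 0 at this
    rw [hS.sk] at this
    linarith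
  have g2 : ∀ x ∈ C, ∀ y ∈ LinearMap.BilinForm.orthogonal S.B C, S.B x y = 0 :=
    fun x hx y hy => hy x hx
  rcases hI C _ hc hJ g1 g2 hv with h | h
  · exact absurd h h0
  · have := hc.sup_eq_top
    rwa [h, sup_bot_eq] at this
theorem minpoly_pow (q : Polynomial ℝ) (S : Str) (hS : SGood q S) (hI : SIndec S)
    [Nontrivial S.V] (d : S.V →ₗ[ℝ] S.V)
    (hc : ∀ x, d (S.J x) = S.J (d x)) (hsa : ∀ x y, S.B (d x) y = S.B x (d y))
    (α : ℝ) (hv : d S.v = α • S.v) :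
    ∃ P : Polynomial ℝ, P.Monic ∧ Irreducible P ∧ P ∣ minpoly ℝ d ∧
      ∃ k, Polynomial.aeval d (P ^ k) = 0 := by
  have hint : IsIntegral ℝ d := Algebra.IsIntegral.isIntegral d
  obtain ⟨P, hPm, hPi, hPd⟩ := Polynomial.exists_monic_irreducible_factor (minpoly ℝ d)
    (minpoly.not_isUnit ℝ d)
  refine ⟨P, hPm, hPi, hPd, ?_⟩
  have hne : minpoly ℝ d ≠ 0 := minpoly.ne_zero hint
  have hfin : FiniteMultiplicity P (minpoly ℝ d) :=
    FiniteMultiplicity.of_not_isUnit hPi.not_isUnit hne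
  obtain ⟨b, hb, hPb⟩ := hfin.exists_eq_pow_mul_and_not_dvd
  set k := multiplicity P (minpoly ℝ d)
  refine ⟨k, ?_⟩
  have hcop : IsCoprime (P ^ k) b := IsCoprime.pow_left ((hPi.coprime_iff_not_dvd).2 hPb)
  have hcompl : IsCompl (LinearMap.ker (Polynomial.aeval d (P ^ k)))
      (LinearMap.ker (Polynomial.aeval d b)) := by
    refine ⟨Polynomial.disjoint_ker_aeval_of_isCoprime d hcop, ?_⟩
    rw [codisjoint_iff, Polynomial.sup_ker_aeval_eq_ker_aeval_mul_of_coprime d hcop, ← hb,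
      minpoly.aeval, LinearMap.ker_zero]
  have hst : ∀ f : Polynomial ℝ, ∀ x ∈ LinearMap.ker (Polynomial.aeval d f),
      S.J x ∈ LinearMap.ker (Polynomial.aeval d f) := by
    intro f x hx
    rw [LinearMap.mem_ker] at *
    rw [← aeval_comm_app d S.J (fun x => (hc x).symm), hx, map_zero]
  have horth : ∀ x ∈ LinearMap.ker (Polynomial.aeval d (P ^ k)),
      ∀ y ∈ LinearMap.ker (Polynomial.aeval d b), S.B x y = 0 := by
    intro x hx y hy
    rw [LinearMap.mem_ker] at hx hy
    obtain ⟨s, t, hst⟩ := hcop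
    have : y = Polynomial.aeval d (P ^ k) (Polynomial.aeval d s y) := by
      rw [← aeval_mul_app]
      have h2 : Polynomial.aeval d (s * P ^ k + t * b) y = y := by rw [hst]; simp
      rw [map_add, LinearMap.add_apply, aeval_mul_app d t b, hy, map_zero, add_zero] at h2
      rw [mul_comm, h2]
    rw [this, ← aeval_selfadj d S.B hsa, hx]; simp
  have horth' : ∀ x ∈ LinearMap.ker (Polynomial.aeval d b),
      ∀ y ∈ LinearMap.ker (Polynomial.aeval d (P ^ k)), S.B x y = 0 := fun x hx y hy => by
    rw [alt_neg _ hS.alt, horth y hy x hx, neg_zero]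
  have hbot : LinearMap.ker (Polynomial.aeval d (P ^ k)) = ⊥ ∨
      LinearMap.ker (Polynomial.aeval d b) = ⊥ := by
    have hva : S.v ∈ LinearMap.ker (Polynomial.aeval d (P ^ k)) ∨
        S.v ∈ LinearMap.ker (Polynomial.aeval d b) := by
      rw [LinearMap.mem_ker, LinearMap.mem_ker, aeval_eig d α _ hv, aeval_eig d α _ hv]
      have h0 : (minpoly ℝ d).eval α • S.v = 0 := by
        rw [← aeval_eig d α _ hv, minpoly.aeval]; rfl
      rw [hb, Polynomial.eval_mul, mul_smul, smul_eq_zero] at h0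
      rcases h0 with h0 | h0
      · left; rw [h0, zero_smul]
      · right; exact h0
    rcases hva with h | h
    · exact hI _ _ hcompl (hst _) (hst _) horth h
    · exact (hI _ _ hcompl.symm (hst _) (hst _) horth' h).symm
  have hk : LinearMap.ker (Polynomial.aeval d (P ^ k)) ≠ ⊥ := by
    intro h
    obtain ⟨c, hc⟩ := hPd
    have hinj : ∀ x, Polynomial.aeval d P x = 0 → x = 0 := by
      intro x hx
      have : x ∈ LinearMap.ker (Polynomial.aeval d (P ^ k)) := by
        rw [LinearMap.mem_ker]
        have hk0 : k ≠ 0 := by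
          intro h0
          rw [h0, pow_zero, one_mul] at hb
          exact hPb (hb ▸ ⟨c, hc⟩)
        obtain ⟨j, hj⟩ := Nat.exists_eq_succ_of_ne_zero hk0
        rw [hj, Nat.succ_eq_add_one, pow_succ, aeval_mul_app, hx, map_zero]
      rw [h] at this
      simpa using this
    have hc0 : Polynomial.aeval d c = 0 := by
      apply LinearMap.ext
      intro x
      apply hinj
      rw [← aeval_mul_app, ← hc, minpoly.aeval]; rfl
    have hcd := minpoly.dvd ℝ d hc0
    rw [hc] at hcd
    have hc00 : c ≠ 0 := by
      rintro rfl
      rw [mul_zero] at hc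
      exact hne hc
    have : P * c ∣ 1 * c := by rwa [one_mul]
    have := (mul_dvd_mul_iff_right hc00).1 this
    exact hPi.not_isUnit (isUnit_of_dvd_one this)
  have hb0 := hbot.resolve_left hk
  have := hcompl.sup_eq_top
  rw [hb0, sup_bot_eq] at this
  exact LinearMap.ker_eq_top.1 this

/-- The type predicate. -/
def STy (m₁ m₂ r : Polynomial ℝ) (t : Bool) (S : Str) : Prop :=
  ∃ x y : S.V,
    (∀ w, ∃ f g : Polynomial ℝ, Polynomial.aeval S.J f x + Polynomial.aeval S.J g y = w) ∧
    (∀ f g : Polynomial ℝ, Polynomial.aeval S.J f x + Polynomial.aeval S.J g y = 0 ↔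
      m₁ ∣ f ∧ m₂ ∣ g) ∧
    S.v = Polynomial.aeval S.J r x ∧
    (t = true → ∀ f : Polynomial ℝ, S.B (Polynomial.aeval S.J f x) S.v = 0) ∧
    (S.v ≠ 0 → ∀ w, (∀ l : ℝ, S.J S.v = l • S.v → S.J w = l • w) →
      (t = true → ∀ f : Polynomial ℝ, S.B (Polynomial.aeval S.J f x) w = 0) →
      ∃ a : ℝ, w = a • S.v)

/-- The parametrising map. -/
def pmap {V : Type*} [AddCommGroup V] [Module ℝ V] (J : V →ₗ[ℝ] V) (x y : V) :
    (Polynomial ℝ × Polynomial ℝ) →ₗ[ℝ] V :=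
  ((LinearMap.applyₗ x) ∘ₗ (Polynomial.aeval J).toLinearMap).coprod
    ((LinearMap.applyₗ y) ∘ₗ (Polynomial.aeval J).toLinearMap)

theorem pmap_apply {V : Type*} [AddCommGroup V] [Module ℝ V] (J : V →ₗ[ℝ] V) (x y : V)
    (f g : Polynomial ℝ) :
    pmap J x y (f, g) = Polynomial.aeval J f x + Polynomial.aeval J g y := by
  simp [pmap]

theorem exists_equiv {V V' : Type*} [AddCommGroup V] [Module ℝ V] [AddCommGroup V'] [Module ℝ V']
    (J : V →ₗ[ℝ] V) (J' : V' →ₗ[ℝ] V') (x y : V) (x' y' : V') (m₁ m₂ : Polynomial ℝ)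
    (h1 : ∀ w, ∃ f g : Polynomial ℝ, Polynomial.aeval J f x + Polynomial.aeval J g y = w)
    (h2 : ∀ f g : Polynomial ℝ, Polynomial.aeval J f x + Polynomial.aeval J g y = 0 ↔
      m₁ ∣ f ∧ m₂ ∣ g)
    (h1' : ∀ w, ∃ f g : Polynomial ℝ, Polynomial.aeval J' f x' + Polynomial.aeval J' g y' = w)
    (h2' : ∀ f g : Polynomial ℝ, Polynomial.aeval J' f x' + Polynomial.aeval J' g y' = 0 ↔
      m₁ ∣ f ∧ m₂ ∣ g) :
    ∃ e : V ≃ₗ[ℝ] V', (∀ z, e (J z) = J' (e z)) ∧ e x = x' := by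
  have hs : LinearMap.range (pmap J x y) = ⊤ := by
    rw [LinearMap.range_eq_top]
    intro w
    obtain ⟨f, g, h⟩ := h1 w
    exact ⟨(f, g), by rw [pmap_apply, h]⟩
  have hs' : LinearMap.range (pmap J' x' y') = ⊤ := by
    rw [LinearMap.range_eq_top]
    intro w
    obtain ⟨f, g, h⟩ := h1' w
    exact ⟨(f, g), by rw [pmap_apply, h]⟩
  have hk : LinearMap.ker (pmap J x y) = LinearMap.ker (pmap J' x' y') := by
    ext ⟨f, g⟩
    rw [LinearMap.mem_ker, LinearMap.mem_ker, pmap_apply, pmap_apply, h2, h2']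
  let e := ((pmap J x y).quotKerEquivOfSurjective (LinearMap.range_eq_top.1 hs)).symm ≪≫ₗ
    (Submodule.quotEquivOfEq _ _ hk) ≪≫ₗ
    ((pmap J' x' y').quotKerEquivOfSurjective (LinearMap.range_eq_top.1 hs'))
  have he : ∀ z, e (pmap J x y z) = pmap J' x' y' z := by
    intro z
    have : ((pmap J x y).quotKerEquivOfSurjective (LinearMap.range_eq_top.1 hs)).symm
        (pmap J x y z) = Submodule.Quotient.mk z := by
      rw [LinearEquiv.symm_apply_eq]; rfl
    simp only [e, LinearEquiv.trans_apply, this, Submodule.quotEquivOfEq_mk]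
    rfl
  refine ⟨e, ?_, ?_⟩
  · intro z
    obtain ⟨f, g, rfl⟩ := h1 z
    rw [← pmap_apply, he]
    have a1 : J (pmap J x y (f, g)) = pmap J x y (Polynomial.X * f, Polynomial.X * g) := by
      simp [pmap_apply]
    have a2 : J' (pmap J' x' y' (f, g)) = pmap J' x' y' (Polynomial.X * f, Polynomial.X * g) := by
      simp [pmap_apply]
    rw [a1, he, a2]
  · have := he (1, 0)
    simpa [pmap_apply] using this

theorem transfer (q : Polynomial ℝ) (m₁ m₂ r : Polynomial ℝ) (t : Bool) (S S' : Str)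
    (hS : SGood q S) (hS' : SGood q S') (hI : SIndec S) (hT : STy m₁ m₂ r t S)
    (hT' : STy m₁ m₂ r t S') : SIso S' S ∨ SIso S' (sneg S) := by
  obtain ⟨x, y, h1, h2, h3, h4, h5⟩ := hT
  obtain ⟨x', y', h1', h2', h3', h4', h5'⟩ := hT'
  obtain ⟨e, heJ, hex⟩ := exists_equiv S.J S'.J x y x' y' m₁ m₂ h1 h2 h1' h2'
  have heJs : ∀ z, e.symm (S'.J z) = S.J (e.symm z) := by
    intro z; rw [LinearEquiv.symm_apply_eq, heJ]; simp
  have hef : ∀ (f : Polynomial ℝ) z, e (Polynomial.aeval S.J f z) = Polynomial.aeval S'.J f (e z) :=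
    fun f z => aeval_intertwine S.J S'.J e.toLinearMap heJ f z
  have hev : e S.v = S'.v := by rw [h3, hef, hex, ← h3']
  have hevs : e.symm S'.v = S.v := by rw [LinearEquiv.symm_apply_eq, hev]
  rcases subsingleton_or_nontrivial S.V with hsub | hnt
  · left
    refine ⟨e.symm, heJs, ?_, 1, one_ne_zero, Subsingleton.elim _ _⟩
    intro a b
    rw [Subsingleton.elim (e.symm a) 0]
    have : a = 0 := by
      have := Subsingleton.elim (e.symm a) 0
      simpa using this
    simp [this]
  -- the operator d
  let β := LinearMap.linearEquivOfInjective S.B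
    ((injective_iff_map_eq_zero S.B).2 fun a ha => hS.nd a fun b => by rw [ha]; rfl)
    (Subspace.dual_finrank_eq).symm
  let d : S.V →ₗ[ℝ] S.V := β.symm.toLinearMap ∘ₗ (S'.B.compl₁₂ e.toLinearMap e.toLinearMap)
  have hd : ∀ a b, S.B (d a) b = S'.B (e a) (e b) := by
    intro a b
    have : β (d a) = S'.B.compl₁₂ e.toLinearMap e.toLinearMap a := by simp [d]
    have h : S.B (d a) = S'.B.compl₁₂ e.toLinearMap e.toLinearMap a := this
    rw [h]; rfl
  have ext : ∀ a b, (∀ c, S.B a c = S.B b c) → a = b := by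
    intro a b h
    rw [← sub_eq_zero]
    apply hS.nd
    intro c
    simp [h]
  have hdJ : ∀ z, d (S.J z) = S.J (d z) := by
    intro z
    apply ext
    intro c
    rw [hd, hS.sk, hd, heJ, heJ, hS'.sk]
  have hsa : ∀ a b, S.B (d a) b = S.B a (d b) := by
    intro a b
    rw [hd, alt_neg _ hS.alt a, hd, alt_neg _ hS'.alt]
  have hinj : ∀ a, d a = 0 → a = 0 := by
    intro a ha
    have : e a = 0 := by
      apply hS'.nd
      intro b
      have := hd a (e.symm b)
      rw [ha] at this
      simpa using this.symm
    simpa using this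
  obtain ⟨α, hα⟩ : ∃ α : ℝ, d S.v = α • S.v := by
    by_cases hv : S.v = 0
    · exact ⟨0, by simp [hv]⟩
    · apply h5 hv
      · intro l hl
        rw [← hdJ, hl, map_smul]
      · intro ht f
        rw [← hsa, hd, hev, hef, hex, h4' ht]
  obtain ⟨P, hPm, hPi, hPd, k, hk⟩ := minpoly_pow q S hS hI d hdJ hsa α hα
  have hPX : ¬ P ∣ Polynomial.X := by
    intro h
    have hass : Associated P Polynomial.X := hPi.associated_of_dvd Polynomial.irreducible_X h
    have hXk : Polynomial.aeval d (Polynomial.X ^ k : Polynomial ℝ) = 0 := by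
      obtain ⟨c, hc⟩ := (hass.pow_pow (n := k)).dvd
      rw [hc, map_mul, hk, zero_mul]
    rw [map_pow, Polynomial.aeval_X] at hXk
    obtain ⟨z, hz⟩ := exists_ne (0 : S.V)
    have : ∀ j : ℕ, (d ^ j) z ≠ 0 := by
      intro j
      induction j with
      | zero => simpa using hz
      | succ j ih =>
        rw [pow_succ']
        exact fun h => ih (hinj _ h)
    exact this k (by rw [hXk]; rfl)
  obtain ⟨σ, hσ, s, w, hs⟩ := sqrt_poly P hPi hPm hPX k
  set H := Polynomial.aeval d s with hH
  have hHH : ∀ z, H (H z) = σ • d z := by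
    intro z
    have := congrArg (fun f => Polynomial.aeval d f z) hs
    simp only [map_sub, map_mul, hk, zero_mul, map_pow, Polynomial.aeval_C, Polynomial.aeval_X,
      LinearMap.sub_apply, LinearMap.zero_apply, sub_eq_zero] at this
    rw [← hH, pow_two] at this
    simpa using this
  have hσ2 : σ * σ = 1 := by rcases hσ with rfl | rfl <;> norm_num
  have hσ0 : σ ≠ 0 := by rintro rfl; norm_num at hσ2
  have hHinj : Function.Injective H := by
    rw [injective_iff_map_eq_zero]
    intro a ha
    have := hHH a
    rw [ha, map_zero] at this
    exact hinj a ((smul_eq_zero.1 this.symm).resolve_left hσ0)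
  let E := LinearEquiv.ofInjectiveEndo H hHinj
  have hE : ∀ z, E z = H z := fun z => rfl
  have hHB : ∀ a b, S.B (H a) (H b) = σ * S'.B (e a) (e b) := by
    intro a b
    rw [← aeval_selfadj d S.B hsa, ← hH, hHH, map_smul, LinearMap.smul_apply, hd]; rfl
  have hHJ : ∀ z, H (S.J z) = S.J (H z) := fun z =>
    (aeval_comm_app d S.J (fun x => (hdJ x).symm) s z).symm
  have hHv : ∃ a : ℝ, a ≠ 0 ∧ H S.v = a • S.v := by
    by_cases hv : S.v = 0
    · exact ⟨1, one_ne_zero, by simp [hv]⟩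
    · refine ⟨s.eval α, ?_, aeval_eig d α _ hα s⟩
      intro h0
      have h6 : H S.v = s.eval α • S.v := aeval_eig d α _ hα s
      rw [h0, zero_smul] at h6
      exact hv (hHinj (by rw [h6, map_zero]))
  obtain ⟨a, ha, hav⟩ := hHv
  rcases hσ with rfl | rfl
  · left
    refine ⟨e.symm.trans E, ?_, ?_, a, ha, ?_⟩
    · intro z
      simp only [LinearEquiv.trans_apply, hE, heJs, hHJ]
    · intro z z'
      simp only [LinearEquiv.trans_apply, hE, hHB]
      simp
    · simp only [LinearEquiv.trans_apply, hE, hevs, hav]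
  · right
    refine ⟨e.symm.trans E, ?_, ?_, a, ha, ?_⟩
    · intro z
      change H (e.symm (S'.J z)) = S.J (H (e.symm z))
      rw [heJs, hHJ]
    · intro z z'
      change - S.B (H (e.symm z)) (H (e.symm z')) = _
      rw [hHB]
      simp
    · change H (e.symm S'.v) = a • S.v
      rw [hevs, hav]
/-- The finite set of types. -/
def Kset (q : Polynomial ℝ) : Set (Polynomial ℝ × Polynomial ℝ × Polynomial ℝ × Bool) :=
  insert (1, 1, 0, false)
    ((fun k : Polynomial ℝ × ℕ × Bool × Bool =>
      (k.1 ^ (k.2.1 + 1), (if k.2.2.1 then (k.1.comp (-Polynomial.X)) ^ (k.2.1 + 1) else 1),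
        (if k.2.2.2 then k.1 ^ k.2.1 else 0), k.2.2.1)) ''
      ({p | p ∈ UniqueFactorizationMonoid.normalizedFactors q} ×ˢ
        (Set.Iic q.natDegree ×ˢ (Set.univ ×ˢ Set.univ))))

theorem Kset_finite (q : Polynomial ℝ) : (Kset q).Finite := by
  classical
  apply Set.Finite.insert
  apply Set.Finite.image
  apply Set.Finite.prod
  · have : {p | p ∈ UniqueFactorizationMonoid.normalizedFactors q}
      = ((UniqueFactorizationMonoid.normalizedFactors q).toFinset : Set (Polynomial ℝ)) := by
      ext x; exact Multiset.mem_toFinset.symm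
    rw [this]
    exact Finset.finite_toSet _
  · exact (Set.finite_Iic _).prod (Set.finite_univ.prod Set.finite_univ)

theorem irreducible_comp_neg (p : Polynomial ℝ) (hp : Irreducible p) :
    Irreducible (p.comp (-Polynomial.X)) := by
  have h : p.comp (-Polynomial.X) = Polynomial.algEquivAevalNegX p := by
    simp [Polynomial.algEquivAevalNegX, Polynomial.comp, Polynomial.aeval_def]
  rw [h]
  exact (MulEquiv.irreducible_iff Polynomial.algEquivAevalNegX).2 hp

theorem core_type (q : Polynomial ℝ) (hq : q ≠ 0) (S : Str) (hS : SGood q S) (hI : SIndec S)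
    (p : Polynomial ℝ) (hp : Irreducible p) (hpm : p.Monic) (v : S.V) (hv0 : v ≠ 0)
    (hpv : Polynomial.aeval S.J p v = 0)
    (hv : S.v = 0 ∨ (S.v = v ∧ ∃ l : ℝ, p = Polynomial.X - Polynomial.C l ∧ S.J v = l • v)) :
    ∃ k ∈ Kset q, STy k.1 k.2.1 k.2.2.1 k.2.2.2 S := by
  classical
  set J := S.J with hJ
  set B := S.B with hB
  -- height
  have hdeg : ∀ h (x : S.V), Polynomial.aeval J (p ^ h) x = v → p ^ (h + 1) ∣ q := by
    intro h x hx
    apply ann_pow J p hp h x q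
    · rw [pow_succ', aeval_mul_app, hx, hpv]
    · rw [hx]; exact hv0
    · rw [hS.ann]; rfl
  have hdeg' : ∀ h, p ^ (h + 1) ∣ q → h + 1 ≤ q.natDegree := by
    intro h hd
    have := Polynomial.natDegree_le_of_dvd hd hq
    rw [Polynomial.natDegree_pow] at this
    have := hp.natDegree_pos
    nlinarith
  have hex : ∃ H, v ∉ LinearMap.range (Polynomial.aeval J (p ^ H)) := by
    by_contra hc
    push Not at hc
    obtain ⟨x, hx⟩ := hc q.natDegree
    have := hdeg' _ (hdeg _ x hx)
    omega
  obtain ⟨h, x, hx, hh⟩ : ∃ h x, Polynomial.aeval J (p ^ h) x = v ∧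
      v ∉ LinearMap.range (Polynomial.aeval J (p ^ (h + 1))) := by
    have h1 := Nat.find_spec hex
    have h0 : Nat.find hex ≠ 0 := by
      intro h0
      rw [h0] at h1
      apply h1
      exact ⟨v, by simp⟩
    obtain ⟨h, hh⟩ := Nat.exists_eq_succ_of_ne_zero h0
    have h2 := Nat.find_min hex (m := h) (by omega)
    push Not at h2
    obtain ⟨x, hx⟩ := h2
    exact ⟨h, x, hx, by rw [hh] at h1; exact h1⟩
  have hpq : p ^ (h + 1) ∣ q := hdeg h x hx
  have hhq : h + 1 ≤ q.natDegree := hdeg' h hpq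
  have hpmem : p ∈ UniqueFactorizationMonoid.normalizedFactors q := by
    rw [UniqueFactorizationMonoid.mem_normalizedFactors_iff' hq]
    exact ⟨hp, hpm.normalize_eq_self, (dvd_pow_self p (by omega)).trans hpq⟩
  set p' := p.comp (-Polynomial.X) with hp'
  have hp'i : Irreducible p' := irreducible_comp_neg p hp
  have hadj := aeval_adj J B hS.sk
  have hpow : ∀ n : ℕ, (p ^ n).comp (-Polynomial.X) = p' ^ n := fun n => by
    rw [Polynomial.pow_comp]
  have hxz : Polynomial.aeval J (p ^ (h + 1)) x = 0 := by
    rw [pow_succ', aeval_mul_app, hx, hpv]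
  have hx1 : Polynomial.aeval J (p ^ h) x ≠ 0 := by rw [hx]; exact hv0
  -- y
  obtain ⟨y, hyv, hyz⟩ : ∃ y, B v y ≠ 0 ∧ Polynomial.aeval J (p' ^ (h + 1)) y = 0 := by
    obtain ⟨φ, hφ1, hφ2⟩ := Submodule.exists_le_ker_of_notMem hh
    have hsurj : ∃ y, B y = φ := by
      let β := LinearMap.linearEquivOfInjective S.B
        ((injective_iff_map_eq_zero S.B).2 fun a ha => hS.nd a fun b => by rw [ha]; rfl)
        (Subspace.dual_finrank_eq).symm
      exact ⟨β.symm φ, β.apply_symm_apply φ⟩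
    obtain ⟨y, rfl⟩ := hsurj
    refine ⟨y, ?_, ?_⟩
    · rw [alt_neg B hS.alt]
      simpa using hφ1
    · apply hS.nd
      intro z
      rw [alt_neg S.B hS.alt, ← hB, ← hpow, ← hadj, alt_neg B hS.alt, neg_neg]
      exact hφ2 ⟨z, rfl⟩
  have hxy : B x (Polynomial.aeval J (p' ^ h) y) ≠ 0 := by
    rw [← hpow, ← hadj, hx]; exact hyv
  have hy1 : Polynomial.aeval J (p' ^ h) y ≠ 0 := by
    intro h0; rw [h0] at hxy; simp at hxy
  -- socle facts
  have socx : ∀ a ∈ cyc J x, a ≠ 0 → ∃ r : Polynomial ℝ, Polynomial.aeval J r a = v := by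
    intro a ha ha0
    obtain ⟨f, rfl⟩ := (mem_cyc _ _ _).1 ha
    rw [← hx]
    apply socle J p hp h x f hxz
    rintro ⟨c, rfl⟩
    apply ha0
    rw [mul_comm, aeval_mul_app, hxz, map_zero]
  have socy : ∀ a ∈ cyc J y, a ≠ 0 →
      ∃ r : Polynomial ℝ, Polynomial.aeval J r a = Polynomial.aeval J (p' ^ h) y := by
    intro a ha ha0
    obtain ⟨f, rfl⟩ := (mem_cyc _ _ _).1 ha
    apply socle J p' hp'i h y f hyz
    rintro ⟨c, rfl⟩
    apply ha0
    rw [mul_comm, aeval_mul_app, hyz, map_zero]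
  have hadj2 : ∀ (f : Polynomial ℝ) a b, B a (Polynomial.aeval J f b) =
      B (Polynomial.aeval J (f.comp (-Polynomial.X)) a) b := by
    intro f a b
    rw [hadj]
    congr 2
    rw [Polynomial.comp_assoc]; simp
  have L1 : ∀ a ∈ cyc J x, (∀ b ∈ cyc J y, B a b = 0) → a = 0 := by
    intro a ha hab
    by_contra ha0
    obtain ⟨r, hr⟩ := socx a ha ha0
    apply hyv
    rw [← hr, hadj]
    exact hab _ (cyc_stable _ _ _ _ (cyc_self _ _))
  have L2 : ∀ b ∈ cyc J y, (∀ a ∈ cyc J x, B a b = 0) → b = 0 := by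
    intro b hb hab
    by_contra hb0
    obtain ⟨r, hr⟩ := socy b hb hb0
    apply hxy
    rw [← hr, hadj2]
    exact hab _ (cyc_stable _ _ _ _ (cyc_self _ _))
  have hvx : v ∈ cyc J x := (mem_cyc _ _ _).2 ⟨_, hx⟩
  have hSv : S.v ∈ cyc J x := by
    rcases hv with h | h
    · rw [h]; exact Submodule.zero_mem _
    · rw [h.1]; exact hvx
  have annx : ∀ f : Polynomial ℝ, Polynomial.aeval J f x = 0 ↔ p ^ (h + 1) ∣ f := by
    intro f
    refine ⟨fun hf => ann_pow J p hp h x f hxz hx1 hf, ?_⟩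
    rintro ⟨c, rfl⟩
    rw [mul_comm, aeval_mul_app, hxz, map_zero]
  have anny : ∀ f : Polynomial ℝ, Polynomial.aeval J f y = 0 ↔ p' ^ (h + 1) ∣ f := by
    intro f
    refine ⟨fun hf => ann_pow J p' hp'i h y f hyz hy1 hf, ?_⟩
    rintro ⟨c, rfl⟩
    rw [mul_comm, aeval_mul_app, hyz, map_zero]
  -- elements of cyc x killed by p
  have killp : ∀ f : Polynomial ℝ, Polynomial.aeval J (p * f) x = 0 →
      ∃ g : Polynomial ℝ, Polynomial.aeval J f x = Polynomial.aeval J g v := by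
    intro f hf
    obtain ⟨c, hc⟩ := (annx _).1 hf
    refine ⟨c, ?_⟩
    have : f = c * p ^ h := by
      apply mul_left_cancel₀ hp.ne_zero
      rw [hc]; ring
    rw [this, aeval_mul_app, hx]
  have hz : ∃ z : Bool, S.v = Polynomial.aeval J (if z then p ^ h else 0) x := by
    rcases hv with h | h
    · exact ⟨false, by simp [h]⟩
    · exact ⟨true, by simp only [if_true]; rw [hx, h.1]⟩
  obtain ⟨z, hz⟩ := hz
  have hJX : ∀ w, J w = Polynomial.aeval J (Polynomial.X : Polynomial ℝ) w := fun w => by simp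
  by_cases hdegen : ∀ a ∈ cyc J x, B a v = 0
  · -- two generators
    have hgv : ∀ (g : Polynomial ℝ), ∀ a ∈ cyc J x, B a (Polynomial.aeval J g v) = 0 := by
      intro g a ha
      rw [hadj2]
      exact hdegen _ (cyc_stable _ _ _ _ ha)
    have hdisj : ∀ a ∈ cyc J x, a ∈ cyc J y → a = 0 := by
      intro a ha hay
      by_contra ha0
      obtain ⟨r, hr⟩ := socx a ha ha0
      apply hv0
      apply L2 v _ hdegen
      rw [← hr]
      exact cyc_stable _ _ _ _ hay
    have hsum0 : ∀ a ∈ cyc J x, ∀ b ∈ cyc J y, a + b = 0 → a = 0 ∧ b = 0 := by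
      intro a ha b hb hab
      have hab' : a = -b := eq_neg_of_add_eq_zero_left hab
      have ha0 : a = 0 := hdisj a ha (by rw [hab']; exact Submodule.neg_mem _ hb)
      refine ⟨ha0, ?_⟩
      rw [ha0, zero_add] at hab
      exact hab
    have hfx : ∀ f : Polynomial ℝ, Polynomial.aeval J f x ∈ cyc J x :=
      fun f => (mem_cyc _ _ _).2 ⟨f, rfl⟩
    have hfy : ∀ f : Polynomial ℝ, Polynomial.aeval J f y ∈ cyc J y :=
      fun f => (mem_cyc _ _ _).2 ⟨f, rfl⟩
    -- no radical killed by p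
    have R1 : ∀ a ∈ cyc J x, ∀ b ∈ cyc J y, (∀ c ∈ cyc J x, B c (a + b) = 0) →
        (∀ c ∈ cyc J y, B c (a + b) = 0) → Polynomial.aeval J p (a + b) = 0 → a + b = 0 := by
      intro a ha b hb hc1 hc2 hpab
      obtain ⟨f, rfl⟩ := (mem_cyc _ _ _).1 ha
      rw [map_add] at hpab
      have := (hsum0 _ (cyc_stable _ _ _ _ ha) _ (cyc_stable _ _ _ _ hb) hpab).1
      rw [← aeval_mul_app] at this
      obtain ⟨g, hg⟩ := killp f this
      have hb0 : b = 0 := by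
        apply L2 b hb
        intro c hc
        have := hc1 c hc
        rwa [map_add, hg, hgv g c hc, zero_add] at this
      subst hb0
      rw [add_zero] at *
      apply L1 _ ha
      intro c hc
      rw [alt_neg B hS.alt, hc2 c hc, neg_zero]
    have R2 : ∀ a ∈ cyc J x, ∀ b ∈ cyc J y, (∀ c ∈ cyc J x, B c (a + b) = 0) →
        (∀ c ∈ cyc J y, B c (a + b) = 0) → Polynomial.aeval J p' (a + b) = 0 → a + b = 0 := by
      intro a ha b hb hc1 hc2 hpab
      by_cases hass : p ∣ p'
      · apply R1 a ha b hb hc1 hc2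
        obtain ⟨c, hc⟩ := (hp.associated_of_dvd hp'i hass).symm.dvd
        rw [hc, mul_comm, aeval_mul_app, hpab, map_zero]
      · have hcop : IsCoprime (p ^ (h + 1)) p' :=
          IsCoprime.pow_left ((hp.coprime_iff_not_dvd).2 hass)
        rw [map_add] at hpab
        have h1 := (hsum0 _ (cyc_stable _ _ _ _ ha) _ (cyc_stable _ _ _ _ hb) hpab).1
        have ha0 : a = 0 := by
          obtain ⟨f, rfl⟩ := (mem_cyc _ _ _).1 ha
          rw [← aeval_mul_app, annx] at h1
          rw [annx]
          exact hcop.dvd_of_dvd_mul_left h1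
        subst ha0
        rw [zero_add] at *
        exact L2 b hb hc1
    have hCtop : cyc J x ⊔ cyc J y = ⊤ := by
      apply indec_top q S hS hI
      · intro w hw
        obtain ⟨a, ha, b, hb, rfl⟩ := Submodule.mem_sup.1 hw
        rw [map_add]
        refine Submodule.add_mem_sup ?_ ?_
        · rw [← hJ, hJX]; exact cyc_stable _ _ _ _ ha
        · rw [← hJ, hJX]; exact cyc_stable _ _ _ _ hb
      · exact Submodule.mem_sup_left hSv
      · intro h0
        have : v ∈ cyc J x ⊔ cyc J y := Submodule.mem_sup_left hvx
        rw [h0] at this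
        exact hv0 (by simpa using this)
      · -- nondegenerate
        -- general step: divide out irreducible factors
        have step : ∀ (P : Polynomial ℝ), (∀ a ∈ cyc J x, ∀ b ∈ cyc J y,
            (∀ c ∈ cyc J x, B c (a + b) = 0) →
            (∀ c ∈ cyc J y, B c (a + b) = 0) → Polynomial.aeval J P (a + b) = 0 → a + b = 0) →
            ∀ n : ℕ, (∀ a ∈ cyc J x, ∀ b ∈ cyc J y,
            (∀ c ∈ cyc J x, B c (a + b) = 0) →
            (∀ c ∈ cyc J y, B c (a + b) = 0) → Polynomial.aeval J (P ^ n) (a + b) = 0 →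
              a + b = 0) := by
          intro P hP n
          induction n with
          | zero =>
            intro a _ b _ _ _ h0
            simpa using h0
          | succ n ih =>
            intro a ha b hb hc1 hc2 h0
            apply ih a ha b hb hc1 hc2
            rw [map_add]
            apply hP _ (cyc_stable _ _ _ _ ha) _ (cyc_stable _ _ _ _ hb)
            · intro c hc
              rw [← map_add, hadj2]
              exact hc1 _ (cyc_stable _ _ _ _ hc)
            · intro c hc
              rw [← map_add, hadj2]
              exact hc2 _ (cyc_stable _ _ _ _ hc)
            · rw [← map_add, ← aeval_mul_app, ← pow_succ', h0]
        intro w hw hwc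
        obtain ⟨a, ha, b, hb, rfl⟩ := Submodule.mem_sup.1 hw
        have hc1 : ∀ c ∈ cyc J x, B c (a + b) = 0 := fun c hc => by
          rw [alt_neg B hS.alt, hB, hwc c (Submodule.mem_sup_left hc), neg_zero]
        have hc2 : ∀ c ∈ cyc J y, B c (a + b) = 0 := fun c hc => by
          rw [alt_neg B hS.alt, hB, hwc c (Submodule.mem_sup_right hc), neg_zero]
        apply step p R1 (h + 1) a ha b hb hc1 hc2
        rw [map_add]
        apply step p' R2 (h + 1) _ (cyc_stable _ _ _ _ ha) _ (cyc_stable _ _ _ _ hb)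
        · intro c hc
          rw [← map_add, hadj2]
          exact hc1 _ (cyc_stable _ _ _ _ hc)
        · intro c hc
          rw [← map_add, hadj2]
          exact hc2 _ (cyc_stable _ _ _ _ hc)
        · obtain ⟨f, rfl⟩ := (mem_cyc _ _ _).1 ha
          obtain ⟨g, rfl⟩ := (mem_cyc _ _ _).1 hb
          rw [map_add]
          simp only [← aeval_mul_app]
          rw [(annx _).2, (anny _).2, add_zero]
          · exact ⟨p ^ (h + 1) * g, by ring⟩
          · exact ⟨p' ^ (h + 1) * f, by ring⟩
    have hgen : ∀ w, ∃ f g : Polynomial ℝ,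
        Polynomial.aeval J f x + Polynomial.aeval J g y = w := by
      intro w
      have hw : w ∈ cyc J x ⊔ cyc J y := by rw [hCtop]; trivial
      obtain ⟨a, ha, b, hb, rfl⟩ := Submodule.mem_sup.1 hw
      obtain ⟨f, rfl⟩ := (mem_cyc _ _ _).1 ha
      obtain ⟨g, rfl⟩ := (mem_cyc _ _ _).1 hb
      exact ⟨f, g, rfl⟩
    refine ⟨(p ^ (h + 1), p' ^ (h + 1), (if z then p ^ h else 0), true), ?_, x, y, hgen, ?_, hz,
      ?_, ?_⟩
    · right
      exact ⟨(p, h, true, z), ⟨hpmem, by simp only [Set.mem_Iic]; omega, trivial, trivial⟩, by simp [hp']⟩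
    · intro f g
      rw [← annx, ← anny]
      refine ⟨fun h0 => hsum0 _ (hfx f) _ (hfy g) h0, fun h0 => ?_⟩
      change Polynomial.aeval J f x + Polynomial.aeval J g y = 0
      rw [h0.1, h0.2, add_zero]
    · intro _ f
      rcases hv with h0 | h0
      · rw [h0, map_zero]
      · rw [h0.1]; exact hdegen _ (hfx f)
    · intro hne w hw1 hw2
      obtain ⟨hvv, l, hpl, hl⟩ := hv.resolve_left hne
      have hwl := hw1 l (by rw [hvv]; exact hl)
      obtain ⟨f, g, rfl⟩ := hgen w
      have hpw : Polynomial.aeval J p (Polynomial.aeval J f x + Polynomial.aeval J g y) = 0 := by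
        rw [aeval_eig J l _ hwl, hpl]; simp
      rw [map_add] at hpw
      have h1 := (hsum0 _ (cyc_stable _ _ _ _ (hfx f)) _ (cyc_stable _ _ _ _ (hfy g)) hpw).1
      rw [← aeval_mul_app] at h1
      obtain ⟨c, hc⟩ := killp f h1
      have hg0 : Polynomial.aeval J g y = 0 := by
        apply L2 _ (hfy g)
        intro a ha
        obtain ⟨f', rfl⟩ := (mem_cyc _ _ _).1 ha
        have := hw2 rfl f'
        rwa [map_add, hc, hgv c _ ha, zero_add] at this
      refine ⟨c.eval l, ?_⟩
      rw [hg0, add_zero, hc, hvv, aeval_eig J l v hl]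
  · -- one generator
    push Not at hdegen
    have hCtop : cyc J x = ⊤ := by
      apply indec_top q S hS hI _ _ hSv
      · intro h0
        rw [h0] at hvx
        exact hv0 (by simpa using hvx)
      · intro w hw hwc
        by_contra hw0
        obtain ⟨r, hr⟩ := socx w hw hw0
        obtain ⟨a, ha, hav⟩ := hdegen
        apply hav
        rw [← hr, hadj2, alt_neg B hS.alt, hB, hwc _ (cyc_stable _ _ _ _ ha), neg_zero]
      · intro w hw
        rw [← hJ, hJX]; exact cyc_stable _ _ _ _ hw
    have hgen : ∀ w, ∃ f : Polynomial ℝ, Polynomial.aeval J f x = w := by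
      intro w
      rw [← mem_cyc, hCtop]; trivial
    refine ⟨(p ^ (h + 1), 1, (if z then p ^ h else 0), false), ?_, x, 0, ?_, ?_, hz, ?_, ?_⟩
    · right
      exact ⟨(p, h, false, z), ⟨hpmem, by simp only [Set.mem_Iic]; omega, trivial, trivial⟩, by simp⟩
    · intro w
      obtain ⟨f, hf⟩ := hgen w
      exact ⟨f, 0, by rw [map_zero, add_zero, ← hf]⟩
    · intro f g
      rw [map_zero, add_zero]
      simp only [isUnit_one, IsUnit.dvd, and_true]
      exact annx f
    · intro h0; simp at h0
    · intro hne w hw1 _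
      obtain ⟨hvv, l, hpl, hl⟩ := hv.resolve_left hne
      have hwl := hw1 l (by rw [hvv]; exact hl)
      obtain ⟨f, rfl⟩ := hgen w
      have hpw : Polynomial.aeval J (p * f) x = 0 := by
        rw [aeval_mul_app, aeval_eig J l _ hwl, hpl]; simp
      obtain ⟨c, hc⟩ := killp f hpw
      refine ⟨c.eval l, ?_⟩
      rw [hc, hvv, aeval_eig J l v hl]

theorem indec_type (q : Polynomial ℝ) (hq : q ≠ 0) (S : Str) (hS : SGood q S) (hI : SIndec S) :
    ∃ k ∈ Kset q, STy k.1 k.2.1 k.2.2.1 k.2.2.2 S := by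
  rcases subsingleton_or_nontrivial S.V with hs | hn
  · refine ⟨(1, 1, 0, false), Or.inl rfl, 0, 0, ?_, ?_, ?_, ?_, ?_⟩
    · intro w; exact ⟨0, 0, Subsingleton.elim _ _⟩
    · intro f g; simp
    · exact Subsingleton.elim _ _
    · intro h; simp at h
    · intro h; exact absurd (Subsingleton.elim _ _) h
  by_cases hv : S.v = 0
  · have hint : IsIntegral ℝ S.J := Algebra.IsIntegral.isIntegral S.J
    obtain ⟨p, hpm, hpi, r, hr⟩ := Polynomial.exists_monic_irreducible_factor (minpoly ℝ S.J)
      (minpoly.not_isUnit ℝ S.J)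
    have hne := minpoly.ne_zero hint
    have hr0 : r ≠ 0 := by rintro rfl; rw [mul_zero] at hr; exact hne hr
    have : Polynomial.aeval S.J r ≠ 0 := by
      intro h0
      have hd := minpoly.dvd ℝ S.J h0
      rw [hr] at hd
      have : p * r ∣ 1 * r := by rwa [one_mul]
      exact hpi.not_isUnit (isUnit_of_dvd_one ((mul_dvd_mul_iff_right hr0).1 this))
    obtain ⟨w, hw⟩ : ∃ w, Polynomial.aeval S.J r w ≠ 0 := by
      by_contra hc
      push Not at hc
      exact this (LinearMap.ext hc)
    apply core_type q hq S hS hI p hpi hpm _ hw _ (Or.inl hv)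
    rw [← aeval_mul_app, ← hr, minpoly.aeval]; rfl
  · obtain ⟨l, hl⟩ := hS.eig
    apply core_type q hq S hS hI (Polynomial.X - Polynomial.C l) (Polynomial.irreducible_X_sub_C l)
      (Polynomial.monic_X_sub_C l) S.v hv _ (Or.inr ⟨rfl, l, rfl, hl⟩)
    rw [aeval_eig S.J l _ hl]; simp

theorem finIso_good (q : Polynomial ℝ) (hq : q ≠ 0) (n : ℕ) :
    FinIso (fun S => SGood q S ∧ Module.finrank ℝ S.V = n) := by
  classical
  induction n using Nat.strong_induction_on with
  | _ n ih =>
  choose L hLf hL using ih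
  let LD : Set Str := ⋃ (i : Fin n) (j : Fin n), Set.image2 ssum (L i i.2) (L j j.2)
  have hLD : LD.Finite := Set.finite_iUnion fun i => Set.finite_iUnion fun j =>
    Set.Finite.image2 _ (hLf _ _) (hLf _ _)
  let Q : Polynomial ℝ × Polynomial ℝ × Polynomial ℝ × Bool → Str → Prop := fun k S =>
    SGood q S ∧ SIndec S ∧ STy k.1 k.2.1 k.2.2.1 k.2.2.2 S
  let S₀ : Str := ⟨Unit → ℝ, 0, 0, 0⟩
  let rep : Polynomial ℝ × Polynomial ℝ × Polynomial ℝ × Bool → Str := fun k =>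
    if h : ∃ S, Q k S then h.choose else S₀
  refine ⟨LD ∪ (rep '' Kset q ∪ (fun k => sneg (rep k)) '' Kset q),
    hLD.union (((Kset_finite q).image _).union ((Kset_finite q).image _)), ?_⟩
  rintro S ⟨hS, hn⟩
  by_cases hI : SIndec S
  · obtain ⟨k, hk, hT⟩ := indec_type q hq S hS hI
    have hex : ∃ S, Q k S := ⟨S, hS, hI, hT⟩
    have hrep : Q k (rep k) := by
      simp only [rep, dif_pos hex]
      exact hex.choose_spec
    obtain ⟨h1, h2, h3⟩ := hrep
    rcases transfer q _ _ _ _ (rep k) S h1 hS h2 h3 hT with h | h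
    · exact ⟨_, Or.inr (Or.inl ⟨k, hk, rfl⟩), h⟩
    · exact ⟨_, Or.inr (Or.inr ⟨k, hk, rfl⟩), h⟩
  · obtain ⟨S₁, S₂, g1, g2, d1, d2, hiso⟩ := decomp q S hS hI
    rw [hn] at d1 d2
    obtain ⟨T₁, hT₁, i1⟩ := hL _ d1 S₁ ⟨g1, rfl⟩
    obtain ⟨T₂, hT₂, i2⟩ := hL _ d2 S₂ ⟨g2, rfl⟩
    refine ⟨ssum T₁ T₂, Or.inl ?_, hiso.trans (ssum_congr i1 i2)⟩
    exact Set.mem_iUnion.2 ⟨⟨_, d1⟩, Set.mem_iUnion.2 ⟨⟨_, d2⟩, Set.mem_image2_of_mem hT₁ hT₂⟩⟩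

theorem exists_str {E : Type} [AddCommGroup E] [Module ℝ E] [FiniteDimensional ℝ E]
    (D : E →ₗ[ℝ] E) (φ : E →ₗ[ℝ] ℝ) (e1 : E) (hφ : φ ≠ 0) (hD : ∀ y, φ (D y) = 0)
    (w : E →ₗ[ℝ] E →ₗ[ℝ] ℝ)
    (alt : ∀ x, w x x = 0) (nd : ∀ x, (∀ y, w x y = 0) → x = 0)
    (cl : ∀ y z, w (D y) z + w y (D z) = φ y * w e1 (D z) - φ z * w e1 (D y)) :
    ∃ u v : E, (∀ z, w u z = - w e1 (D z)) ∧ (∀ y, w y v = φ y) ∧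
      SGood (D.charpoly * D.charpoly.comp (-Polynomial.X)) ⟨E, D + φ.smulRight u, w, v⟩ := by
  have hinj : Function.Injective w := by
    rw [injective_iff_map_eq_zero]
    intro x hx
    exact nd x (fun y => by rw [hx]; rfl)
  have hsurj : Function.Surjective w :=
    (LinearMap.injective_iff_surjective_of_finrank_eq_finrank
      (Subspace.dual_finrank_eq (K := ℝ) (V := E)).symm).1 hinj
  obtain ⟨u, hu⟩ := hsurj (- (w e1).comp D)
  obtain ⟨v, hv⟩ := hsurj (-φ)
  have hu' : ∀ z, w u z = - w e1 (D z) := fun z => by rw [hu]; rfl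
  have hv' : ∀ y, w y v = φ y := fun y => by rw [alt_neg w alt, hv]; simp
  set T := D + φ.smulRight u with hT
  have hTa : ∀ y, T y = D y + φ y • u := fun y => rfl
  have sk : ∀ x y, w (T x) y = - w x (T y) := by
    intro x y
    have h := cl x y
    have h2 := alt_neg w alt x u
    simp only [hTa, map_add, map_smul, LinearMap.add_apply, LinearMap.smul_apply, smul_eq_mul, h2, hu']
    linarith
  have eig : T v = (-(φ u)) • v := by
    rw [← sub_eq_zero]
    apply nd
    intro y
    rw [alt_neg w alt, map_sub, map_smul, hv']
    have := sk y v
    rw [hv', hTa, map_add, hD, map_smul] at this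
    simp only [smul_eq_mul, ← hTa] at this ⊢
    linarith
  have hv0 : v ≠ 0 := by
    rintro rfl
    apply hφ
    ext y
    rw [← hv']; simp
  have hφv : φ v = 0 := by rw [← hv', alt]
  have hDv : D v = (-(φ u)) • v := by rw [← eig, hTa, hφv, zero_smul, add_zero]
  have hroot : D.charpoly.eval (-(φ u)) = 0 := by
    have := aeval_eig D _ v hDv D.charpoly
    rw [LinearMap.aeval_self_charpoly] at this
    have := this.symm
    simpa [hv0] using this
  have hdvd : (Polynomial.X - Polynomial.C (φ u)) ∣ D.charpoly.comp (-Polynomial.X) := by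
    rw [Polynomial.dvd_iff_isRoot, Polynomial.IsRoot, Polynomial.eval_comp]
    simpa using hroot
  have hV0 : ∀ (f : Polynomial ℝ) (z : E), φ z = 0 →
      Polynomial.aeval T f z = Polynomial.aeval D f z := by
    intro f z hz
    have hp : ∀ n : ℕ, (T ^ n) z = (D ^ n) z ∧ φ ((D ^ n) z) = 0 := by
      intro n
      induction n with
      | zero => simpa using hz
      | succ n ih =>
        rw [pow_succ', pow_succ', Module.End.mul_apply, Module.End.mul_apply, ih.1, hTa, ih.2]
        exact ⟨by simp, hD _⟩
    rw [Polynomial.aeval_eq_sum_range, Polynomial.aeval_eq_sum_range]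
    simp [LinearMap.sum_apply, fun n => (hp n).1]
  refine ⟨u, v, hu', hv', ?_, alt, nd, sk, _, eig⟩
  obtain ⟨r, hr⟩ := hdvd
  change Polynomial.aeval T _ = 0
  rw [hr, show D.charpoly * ((Polynomial.X - Polynomial.C (φ u)) * r)
    = r * (D.charpoly * (Polynomial.X - Polynomial.C (φ u))) by ring]
  have : Polynomial.aeval T (D.charpoly * (Polynomial.X - Polynomial.C (φ u))) = 0 := by
    ext y
    rw [aeval_mul_app, hV0, LinearMap.aeval_self_charpoly]
    · simp
    · simp [hTa, hD, Module.algebraMap_end_apply, mul_comm]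
  rw [map_mul, this, mul_zero]

theorem siso_map {E : Type} [AddCommGroup E] [Module ℝ E] [FiniteDimensional ℝ E]
    (D : E →ₗ[ℝ] E) (φ : E →ₗ[ℝ] ℝ) 
    (w1 w2 : E →ₗ[ℝ] E →ₗ[ℝ] ℝ) (u1 v1 u2 v2 : E)
    (h1 : ∀ y, w1 y v1 = φ y) (h2 : ∀ y, w2 y v2 = φ y)
    (h : SIso ⟨E, D + φ.smulRight u1, w1, v1⟩ ⟨E, D + φ.smulRight u2, w2, v2⟩) :
    ∃ (a : ℝ) (M : E ≃ₗ[ℝ] E), a ≠ 0 ∧ (∀ y, φ (M y) = φ y) ∧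
      (∀ x y, M (φ x • D y - φ y • D x) = φ (M x) • D (M y) - φ (M y) • D (M x)) ∧
      (∀ x y, w1 x y = a * w2 (M x) (M y)) := by
  obtain ⟨e, hJ, hB, a, ha, hv⟩ := h
  change E ≃ₗ[ℝ] E at e
  change ∀ x, e (D x + φ x • u1) = D (e x) + φ (e x) • u2 at hJ
  change ∀ x y, w2 (e x) (e y) = w1 x y at hB
  change e v1 = a • v2 at hv
  have hphi : ∀ y, φ (e y) = a⁻¹ * φ y := by
    intro y
    rw [← h2, ← h1, ← hB, hv, map_smul, smul_eq_mul, inv_mul_cancel_left₀ ha]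
  have hphi' : ∀ y, φ (a • e y) = φ y := by
    intro y
    rw [map_smul, hphi, smul_eq_mul, mul_inv_cancel_left₀ ha]
  let M : E ≃ₗ[ℝ] E := e.trans (LinearEquiv.smulOfNeZero ℝ E a ha)
  have hM : ∀ y, M y = a • e y := fun y => rfl
  refine ⟨(a^2)⁻¹, M, by positivity, fun y => by rw [hM, hphi'], ?_, ?_⟩
  · intro x y
    have hD : ∀ z, e (D z) = D (e z) + φ z • (a⁻¹ • u2 - e u1) := by
      intro z
      have := hJ z
      rw [map_add, map_smul, hphi] at this
      rw [eq_sub_of_add_eq this]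
      module
    simp only [hM, hphi', map_sub, map_smul, hD]
    module
  · intro x y
    simp only [hM, map_smul, LinearMap.smul_apply, smul_eq_mul, hB]
    field_simp

theorem form_str {N : ℕ} (J : Matrix (Fin N) (Fin N) ℝ)
    (B : Matrix (Unit ⊕ Fin N) (Unit ⊕ Fin N) ℝ)
    (hB : Bᵀ = -B ∧ IsUnit B ∧ IsClosed2Form J B) :
    ∃ u v : (Unit ⊕ Fin N) → ℝ,
      (∀ y, Matrix.toBilin' B y v = y (Sum.inl ())) ∧
      SGood ((jbar J).mulVecLin.charpoly * (jbar J).mulVecLin.charpoly.comp (-Polynomial.X))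
        ⟨(Unit ⊕ Fin N) → ℝ, (jbar J).mulVecLin +
          (LinearMap.proj (Sum.inl ()) : ((Unit ⊕ Fin N) → ℝ) →ₗ[ℝ] ℝ).smulRight u,
          Matrix.toBilin' B, v⟩ := by
  obtain ⟨h1, h2, h3⟩ := hB
  have hw : ∀ x y, Matrix.toBilin' B x y = x ⬝ᵥ B *ᵥ y := fun x y => Matrix.toBilin'_apply' _ _ _
  have hskew : ∀ x y, x ⬝ᵥ B *ᵥ y = - (y ⬝ᵥ B *ᵥ x) := by
    intro x y
    rw [dotProduct_mulVec, ← mulVec_transpose, h1, neg_mulVec, neg_dotProduct, dotProduct_comm]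
  have hD : ∀ y, ((jbar J) *ᵥ y) (Sum.inl ()) = 0 := by
    intro y
    simp [jbar, Matrix.mulVec, dotProduct]
  have hDe : (jbar J) *ᵥ (Pi.single (Sum.inl ()) 1) = 0 := by
    ext i
    rcases i with i | i <;> simp [jbar]
  obtain ⟨u, v, -, hv, hg⟩ := exists_str (jbar J).mulVecLin
    (LinearMap.proj (Sum.inl ()) : ((Unit ⊕ Fin N) → ℝ) →ₗ[ℝ] ℝ) (Pi.single (Sum.inl ()) 1)
    (fun h => by
      have := LinearMap.congr_fun h (Pi.single (Sum.inl ()) 1)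
      simp at this) hD (Matrix.toBilin' B)
    (fun x => by rw [hw]; linarith [hskew x x])
    (fun x hx => by
      have h0 : B *ᵥ x = 0 := by
        apply dotProduct_eq_zero
        intro y
        rw [dotProduct_comm, hskew, ← hw, hx, neg_zero]
      exact (Matrix.mulVec_injective_iff_isUnit.2 h2) (by simpa using h0))
    (fun y z => by
      have := h3 (Pi.single (Sum.inl ()) 1) y z
      simp only [twoForm, aaBracket, hDe, Pi.single_eq_same, one_smul, smul_zero, sub_zero,
        zero_sub, ← hw, map_sub, map_neg, map_smul, smul_eq_mul] at this
      have h4 := hskew z (jbar J *ᵥ y)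
      rw [← hw, ← hw] at h4
      simp only [Matrix.mulVecLin_apply, LinearMap.proj_apply]
      linarith)
  exact ⟨u, v, hv, hg⟩

/-- The moduli space of symplectic forms on an almost abelian Lie algebra is finite. -/
theorem moduli_space_of_symplectic_forms_finite
    (N : ℕ) (hN : 1 ≤ N) (J : Matrix (Fin N) (Fin N) ℝ) (hJ : J ≠ 0) :
    ∃ F : Set (Matrix (Unit ⊕ Fin N) (Unit ⊕ Fin N) ℝ),
      F.Finite ∧
      F ⊆ {B | Bᵀ = -B ∧ IsUnit B ∧ IsClosed2Form J B} ∧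
      ∀ B ∈ {B : Matrix (Unit ⊕ Fin N) (Unit ⊕ Fin N) ℝ |
          Bᵀ = -B ∧ IsUnit B ∧ IsClosed2Form J B},
        ∃ B' ∈ F, ∃ c : ℝ, c ≠ 0 ∧
          ∃ M : Matrix (Unit ⊕ Fin N) (Unit ⊕ Fin N) ℝ, IsUnit M ∧
            (∀ x y : (Unit ⊕ Fin N) → ℝ,
              M.mulVec (aaBracket J x y) = aaBracket J (M.mulVec x) (M.mulVec y)) ∧
            B' = c • (Mᵀ * B * M) := by
  classical
  let P : Matrix (Unit ⊕ Fin N) (Unit ⊕ Fin N) ℝ → Prop :=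
    fun B => Bᵀ = -B ∧ IsUnit B ∧ IsClosed2Form J B
  have hstr := fun B : {B // P B} => form_str J B.1 B.2
  choose u v hv hg using hstr
  let St : {B // P B} → Str := fun B => ⟨(Unit ⊕ Fin N) → ℝ, (jbar J).mulVecLin +
          (LinearMap.proj (Sum.inl ()) : ((Unit ⊕ Fin N) → ℝ) →ₗ[ℝ] ℝ).smulRight (u B),
          Matrix.toBilin' B.1, v B⟩
  have hq : (jbar J).mulVecLin.charpoly * (jbar J).mulVecLin.charpoly.comp (-Polynomial.X) ≠ 0 := by
    have h0 := ((jbar J).mulVecLin.charpoly_monic).ne_zero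
    refine mul_ne_zero h0 ?_
    intro h
    apply h0
    have := congrArg (fun p => Polynomial.comp p (-Polynomial.X)) h
    simpa [Polynomial.comp_assoc] using this
  obtain ⟨L, hL, hcov⟩ := finIso_good _ hq (Module.finrank ℝ ((Unit ⊕ Fin N) → ℝ))
  let L' : Set Str := {T ∈ L | ∃ B, SIso (St B) T}
  have hL' : L'.Finite := hL.subset (fun _ h => h.1)
  have hrep : ∀ T : L', ∃ B, SIso (St B) T.1 := fun T => T.2.2
  choose rep hrep using hrep
  have := hL'.to_subtype
  refine ⟨Set.range (fun T : L' => (rep T).1), Set.finite_range _, ?_, ?_⟩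
  · rintro _ ⟨T, rfl⟩
    exact (rep T).2
  · intro B hB
    obtain ⟨T, hT, hiso⟩ := hcov (St ⟨B, hB⟩) ⟨hg _, rfl⟩
    let T' : L' := ⟨T, hT, _, hiso⟩
    refine ⟨_, ⟨T', rfl⟩, ?_⟩
    have hs : SIso (St (rep T')) (St ⟨B, hB⟩) := (hrep T').trans hiso.symm
    obtain ⟨a, M, ha, hphi, hbr, hw⟩ := siso_map _ _ _ _ _ _ _ _ (hv _) (hv _) hs
    have hMv : ∀ x, (LinearMap.toMatrix' M.toLinearMap) *ᵥ x = M x :=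
      fun x => LinearMap.toMatrix'_mulVec _ _
    refine ⟨a, ha, LinearMap.toMatrix' M.toLinearMap, ?_, ?_, ?_⟩
    · rw [← Matrix.mulVec_injective_iff_isUnit]
      intro x y hxy
      simp only [hMv] at hxy
      exact M.injective hxy
    · intro x y
      rw [hMv, hMv, hMv]
      exact hbr x y
    · apply Matrix.toBilin'.injective
      apply LinearMap.ext₂
      intro x y
      rw [hw]
      simp only [map_smul, LinearMap.smul_apply, smul_eq_mul, Matrix.toBilin'_apply']
      rw [← hMv, ← hMv, ← Matrix.mulVec_mulVec, ← Matrix.mulVec_mulVec, Matrix.mulVec_transpose,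
        dotProduct_comm x, ← Matrix.dotProduct_mulVec, dotProduct_comm]
end
end

section
/- Let p ≥ 1, let n : Fin p → ℕ with n i ≥ 1 for all i, let λ : Fin p → ℝ, let σ = Σ i, Fin (n i), let N = Σ i, n i, and let 𝒥 = Matrix.blockDiagonal' (fun i => J_{n i}(λ i)) on σ. Assume N is even. If B is a skew-symmetric invertible real matrix on σ with B * 𝒥 + 𝒥ᵀ * B = 0, then there exist an invertible matrix A on σ with A * 𝒥 = 𝒥 * A and a bijection e : σ ≃ Fin N such that reindexing Aᵀ * B * A along e yields the standard symplectic matrix J_N. (Equivalently: B is congruent, via an invertible element of the commutant of 𝒥, to Pᵀ J_N P for a permutation matrix P.) -/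
open Matrix

noncomputable section

/-- The `n×n` real Jordan block with eigenvalue `λ` (0-based indices). -/
def jordanBlock (n : ℕ) (lam : ℝ) : Matrix (Fin n) (Fin n) ℝ :=
  Matrix.of fun i j => if j = i then lam else if (j : ℕ) = (i : ℕ) + 1 then 1 else 0

/-- The real Jordan block `C_n(a,b)` for a complex eigenvalue `a ± i b`, as a matrix of
`2×2` blocks indexed by `Fin n × Fin 2`. -/
def realJordanBlock (n : ℕ) (a b : ℝ) : Matrix (Fin n × Fin 2) (Fin n × Fin 2) ℝ :=
  Matrix.of fun p q =>
    if q.1 = p.1 then !![a, b; -b, a] p.2 q.2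
    else if (q.1 : ℕ) = (p.1 : ℕ) + 1 then (1 : Matrix (Fin 2) (Fin 2) ℝ) p.2 q.2
    else 0

/-- The canonical `2`-form of rank `R` (for `R` even, `R ≤ N`): the `N×N` matrix whose
top-left `R×R` block is `[[0, I_{R/2}], [-I_{R/2}, 0]]` and whose other entries vanish. -/
def canonJ (N R : ℕ) : Matrix (Fin N) (Fin N) ℝ :=
  Matrix.of fun i j =>
    if (i : ℕ) < R / 2 ∧ (j : ℕ) = (i : ℕ) + R / 2 then 1
    else if (j : ℕ) < R / 2 ∧ (i : ℕ) = (j : ℕ) + R / 2 then -1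
    else 0

section aux
variable {V : Type} [AddCommGroup V] [Module ℝ V]

def NN (T : Module.End ℝ V) (μ : ℝ) : Module.End ℝ V := T - μ • 1

lemma NN_apply (T : Module.End ℝ V) (μ : ℝ) (x : V) : NN T μ x = T x - μ • x := by
  simp [NN]

lemma pow_add_apply (N : Module.End ℝ V) (a b : ℕ) (x : V) :
    (N ^ a) ((N ^ b) x) = (N ^ (a + b)) x := by
  rw [pow_add]; rfl

lemma pow_ge_zero (N : Module.End ℝ V) {n k : ℕ} {x : V} (h : (N ^ n) x = 0) (hk : n ≤ k) :
    (N ^ k) x = 0 := by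
  obtain ⟨m, rfl⟩ := Nat.exists_eq_add_of_le hk
  rw [add_comm, ← pow_add_apply, h, map_zero]

lemma pow_mem_inv (N : Module.End ℝ V) (U : Submodule ℝ V) (hU : ∀ x ∈ U, N x ∈ U) (k : ℕ)
    {x : V} (hx : x ∈ U) : (N ^ k) x ∈ U := by
  induction k with
  | zero => simpa using hx
  | succ k ih => rw [pow_succ']; exact hU _ ih

lemma adj_pow (B : V →ₗ[ℝ] V →ₗ[ℝ] ℝ) (M N : Module.End ℝ V)
    (h : ∀ x y, B (M x) y = - B x (N y)) (a : ℕ) (x y : V) :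
    B ((M ^ a) x) y = (-1) ^ a * B x ((N ^ a) y) := by
  induction a generalizing y with
  | zero => simp
  | succ a ih => rw [pow_succ', Module.End.mul_apply, h, ih, ← Module.End.mul_apply, ← pow_succ, pow_succ]; ring

lemma NN_adj (B : V →ₗ[ℝ] V →ₗ[ℝ] ℝ) (T : Module.End ℝ V)
    (h : ∀ x y, B (T x) y = - B x (T y)) (μ ν : ℝ) (hμ : μ + ν = 0) (x y : V) :
    B (NN T μ x) y = - B x (NN T ν y) := by
  have : ν = -μ := by linarith
  subst this
  simp only [NN_apply, map_sub, map_smul, LinearMap.sub_apply, LinearMap.smul_apply, smul_eq_mul, h]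
  ring

/-- orthogonality of different eigenvalues -/
lemma orth_of_ne (B : V →ₗ[ℝ] V →ₗ[ℝ] ℝ) (T : Module.End ℝ V)
    (h : ∀ x y, B (T x) y = - B x (T y)) (μ ν : ℝ) (hμ : μ + ν ≠ 0) :
    ∀ (s a b : ℕ), a + b = s → ∀ x y, (NN T μ ^ a) x = 0 → (NN T ν ^ b) y = 0 → B x y = 0 := by
  intro s
  induction s with
  | zero =>
    intro a b hab x y hx hy
    have : a = 0 := by omega
    subst this
    simp only [pow_zero, Module.End.one_apply] at hx
    simp [hx]
  | succ s ih =>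
    intro a b hab x y hx hy
    rcases a with _ | a
    · simp only [pow_zero, Module.End.one_apply] at hx
      simp [hx]
    rcases b with _ | b
    · simp only [pow_zero, Module.End.one_apply] at hy
      simp [hy]
    have h1 : B (NN T μ x) y = 0 := ih a (b+1) (by omega) _ _ (by rw [pow_succ] at hx; exact hx) hy
    have h2 : B x (NN T ν y) = 0 := ih (a+1) b (by omega) _ _ hx (by rw [pow_succ] at hy; exact hy)
    simp only [NN_apply, map_sub, map_smul, LinearMap.sub_apply, LinearMap.smul_apply, smul_eq_mul, h] at h1 h2
    have : (μ + ν) * B x y = 0 := by linarith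
    exact (mul_eq_zero.mp this).resolve_left hμ

lemma self_even (B : V →ₗ[ℝ] V →ₗ[ℝ] ℝ) (hB : ∀ x y, B x y = - B y x) (N : Module.End ℝ V)
    (h : ∀ x y, B (N x) y = - B x (N y)) (x : V) (k : ℕ) (hk : Even k) : B x ((N ^ k) x) = 0 := by
  have := adj_pow B N N h k x x
  rw [hk.neg_one_pow, hB] at this
  linarith

/-- Case A -/
lemma caseA (B : V →ₗ[ℝ] V →ₗ[ℝ] ℝ) (hB : ∀ x y, B x y = - B y x) (N : Module.End ℝ V)
    (h : ∀ x y, B (N x) y = - B x (N y)) (n : ℕ) (hn : 1 ≤ n) (U : Submodule ℝ V)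
    (hU : ∀ x ∈ U, N x ∈ U) (hU0 : ∀ x ∈ U, (N ^ n) x = 0) (v : V) (hv : v ∈ U)
    (hc : B v ((N ^ (n - 1)) v) ≠ 0) :
    ∃ u ∈ U, (B u ((N ^ (n-1)) u) = 1 ∨ B u ((N ^ (n-1)) u) = -1) ∧
      ∀ k, k ≠ n - 1 → B u ((N ^ k) u) = 0 := by
  have key : ∀ m, ∃ u ∈ U, B u ((N ^ (n-1)) u) ≠ 0 ∧
      ∀ k, n - 1 < k + m → k ≠ n - 1 → B u ((N ^ k) u) = 0 := by
    intro m
    induction m with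
    | zero =>
      refine ⟨v, hv, hc, fun k hk _ => ?_⟩
      rw [pow_ge_zero N (hU0 v hv) (by omega), map_zero]
    | succ m ih =>
      obtain ⟨u, hu, hu1, hu2⟩ := ih
      by_cases hm : m = 0
      · subst hm
        exact ⟨u, hu, hu1, fun k hk hk' => hu2 k (by omega) hk'⟩
      by_cases hmn : n - 1 < m
      · exact ⟨u, hu, hu1, fun k hk hk' => hu2 k (by omega) hk'⟩
      by_cases hme : Even m
      · set c := B u ((N ^ (n-1)) u) with hcdef
        set d := B u ((N ^ (n-1-m)) u) with hd
        set t := - d / (2 * c) with ht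
        have hexp : ∀ k, B (u + t • (N ^ m) u) ((N ^ k) (u + t • (N ^ m) u))
            = B u ((N ^ k) u) + 2 * t * B u ((N ^ (k + m)) u)
              + t ^ 2 * B u ((N ^ (k + m + m)) u) := by
          intro k
          simp only [map_add, map_smul, LinearMap.add_apply, LinearMap.smul_apply, smul_eq_mul,
            adj_pow B N N h m, hme.neg_one_pow, pow_add_apply]
          rw [show m + k = k + m by ring, show m + (k + m) = k + m + m by ring]
          ring
        have hz : ∀ k, n - 1 < k → B u ((N ^ k) u) = 0 := fun k hk => by
          rw [pow_ge_zero N (hU0 u hu) (by omega), map_zero]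
        refine ⟨u + t • (N ^ m) u, U.add_mem hu (U.smul_mem _ (pow_mem_inv N U hU m hu)), ?_, ?_⟩
        · rw [hexp, hz (n-1+m) (by omega), hz (n-1+m+m) (by omega)]
          simpa using hu1
        · intro k hk hk'
          rw [hexp]
          by_cases hkm : n - 1 < k + m
          · rw [hu2 k hkm hk', hz _ hkm, hz (k+m+m) (by omega)]; ring
          · have : k = n - 1 - m := by omega
            subst this
            rw [hz (n-1-m+m+m) (by omega), show n - 1 - m + m = n - 1 by omega, ← hcdef, ← hd, ht]
            field_simp
            ring
      · refine ⟨u, hu, hu1, fun k hk hk' => ?_⟩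
        by_cases hkm : n - 1 < k + m
        · exact hu2 k hkm hk'
        by_cases hke : Even k
        · exact self_even B hB N h u k hke
        · exfalso
          apply hu1
          apply self_even B hB N h u
          have : n - 1 = k + m := by omega
          rw [this]
          rw [Nat.not_even_iff_odd] at *
          exact hke.add_odd hme
  obtain ⟨u, hu, hu1, hu2⟩ := key n
  set c := B u ((N ^ (n-1)) u) with hcdef
  refine ⟨(Real.sqrt |c|)⁻¹ • u, U.smul_mem _ hu, ?_, ?_⟩
  · simp only [map_smul, LinearMap.smul_apply, smul_eq_mul, ← hcdef, ← mul_assoc]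
    rw [← mul_inv, Real.mul_self_sqrt (abs_nonneg _)]
    rcases abs_cases c with ⟨h1, h2⟩ | ⟨h1, h2⟩
    · left; rw [h1]; field_simp
    · right; rw [h1]; field_simp
  · intro k hk
    simp only [map_smul, LinearMap.smul_apply, smul_eq_mul]
    rw [hu2 k (by omega) hk]; simp

/-- Case B, self-orthogonalisation -/
lemma caseB1 (B : V →ₗ[ℝ] V →ₗ[ℝ] ℝ) (hB : ∀ x y, B x y = - B y x) (N : Module.End ℝ V)
    (h : ∀ x y, B (N x) y = - B x (N y)) (n : ℕ) (hn : 1 ≤ n) (U : Submodule ℝ V)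
    (hU : ∀ x ∈ U, N x ∈ U) (hU0 : ∀ x ∈ U, (N ^ n) x = 0) (v w : V) (hv : v ∈ U) (hw : w ∈ U)
    (hc : B v ((N ^ (n - 1)) w) ≠ 0) (hself : B v ((N ^ (n - 1)) v) = 0) :
    ∃ u ∈ U, B u ((N ^ (n-1)) w) ≠ 0 ∧ ∀ k, B u ((N ^ k) u) = 0 := by
  have key : ∀ m, ∃ u ∈ U, B u ((N ^ (n-1)) w) ≠ 0 ∧
      ∀ k, n - 1 ≤ k + m → B u ((N ^ k) u) = 0 := by
    intro m
    induction m with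
    | zero =>
      refine ⟨v, hv, hc, fun k hk => ?_⟩
      by_cases hk' : k = n - 1
      · rw [hk', hself]
      rw [pow_ge_zero N (hU0 v hv) (by omega), map_zero]
    | succ m ih =>
      obtain ⟨u, hu, hu1, hu2⟩ := ih
      by_cases hmn : n - 1 < m + 1
      · exact ⟨u, hu, hu1, fun k hk => hu2 k (by omega)⟩
      by_cases hke : Even (n - 1 - (m+1))
      · refine ⟨u, hu, hu1, fun k hk => ?_⟩
        by_cases hkm : n - 1 ≤ k + m
        · exact hu2 k hkm
        · have : k = n - 1 - (m+1) := by omega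
          subst this
          exact self_even B hB N h u _ hke
      have hz : ∀ k x y, x ∈ U → y ∈ U → n - 1 < k → B x ((N ^ k) y) = 0 := fun k x y hx hy hk => by
          rw [pow_ge_zero N (hU0 y hy) (by omega), map_zero]
      set c := B u ((N ^ (n-1)) w) with hcdef
      set d := B u ((N ^ (n-1-(m+1))) u) with hd
      set t := - d / (2 * c) with ht
      have hexp : ∀ k, B (u + t • (N ^ (m+1)) w) ((N ^ k) (u + t • (N ^ (m+1)) w))
            = B u ((N ^ k) u) + t * (1 - (-1)^k) * B u ((N ^ (k + (m+1))) w)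
              + t ^ 2 * (-1)^(m+1) * B w ((N ^ (k + (m+1) + (m+1))) w) := by
          intro k
          have e1 : B ((N ^ (m+1)) w) ((N ^ k) u) = - ((-1)^k * B u ((N ^ (k+(m+1))) w)) := by
            rw [hB, adj_pow B N N h k, pow_add_apply]
          simp only [map_add, map_smul, LinearMap.add_apply, LinearMap.smul_apply, smul_eq_mul, e1]
          simp only [adj_pow B N N h (m+1), pow_add_apply]
          rw [show (m + 1) + (k + (m+1)) = k + (m+1) + (m+1) by ring]
          ring
      refine ⟨u + t • (N ^ (m+1)) w, U.add_mem hu (U.smul_mem _ (pow_mem_inv N U hU _ hw)), ?_, ?_⟩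
      · simp only [map_add, map_smul, LinearMap.add_apply, LinearMap.smul_apply, smul_eq_mul,
          adj_pow B N N h (m+1), pow_add_apply]
        rw [hz (m + 1 + (n-1)) w w hw hw (by omega)]
        simpa using hu1
      · intro k hk
        rw [hexp]
        by_cases hkm : n - 1 ≤ k + m
        · rw [hu2 k hkm, hz _ _ _ hu hw (by omega), hz _ _ _ hw hw (by omega)]; ring
        · have : k = n - 1 - (m+1) := by omega
          subst this
          rw [hz (n-1-(m+1)+(m+1)+(m+1)) w w hw hw (by omega), show n - 1 - (m+1) + (m+1) = n - 1 by omega,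
            ← hcdef, ← hd, ht, (Nat.not_even_iff_odd.mp hke).neg_one_pow]
          field_simp
          ring
  obtain ⟨u, hu, hu1, hu2⟩ := key n
  exact ⟨u, hu, hu1, fun k => hu2 k (by omega)⟩

/-- Case B, normalisation -/
lemma caseB2 (φ : V →ₗ[ℝ] ℝ) (N : Module.End ℝ V)
    (n : ℕ) (hn : 1 ≤ n) (U : Submodule ℝ V)
    (hU : ∀ x ∈ U, N x ∈ U) (hU0 : ∀ x ∈ U, (N ^ n) x = 0) (v : V) (hv : v ∈ U)
    (hc : φ ((N ^ (n - 1)) v) ≠ 0) :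
    ∃ u ∈ U, φ ((N ^ (n-1)) u) = 1 ∧ ∀ k, k ≠ n - 1 → φ ((N ^ k) u) = 0 := by
  have key : ∀ m, ∃ u ∈ U, φ ((N ^ (n-1)) u) ≠ 0 ∧
      ∀ k, n - 1 ≤ k + m → k ≠ n - 1 → φ ((N ^ k) u) = 0 := by
    intro m
    induction m with
    | zero =>
      refine ⟨v, hv, hc, fun k hk _ => ?_⟩
      rw [pow_ge_zero N (hU0 v hv) (by omega), map_zero]
    | succ m ih =>
      obtain ⟨u, hu, hu1, hu2⟩ := ih
      by_cases hmn : n - 1 < m + 1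
      · exact ⟨u, hu, hu1, fun k hk hk' => hu2 k (by omega) hk'⟩
      have hz : ∀ k, n - 1 < k → φ ((N ^ k) u) = 0 := fun k hk => by
          rw [pow_ge_zero N (hU0 u hu) (by omega), map_zero]
      set c := φ ((N ^ (n-1)) u) with hcdef
      set d := φ ((N ^ (n-1-(m+1))) u) with hd
      refine ⟨u + (-d / c) • (N ^ (m+1)) u, U.add_mem hu (U.smul_mem _ (pow_mem_inv N U hU _ hu)), ?_, ?_⟩
      · simp only [map_add, map_smul, smul_eq_mul, pow_add_apply]
        rw [hz (n-1+(m+1)) (by omega)]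
        simpa using hu1
      · intro k hk hk'
        simp only [map_add, map_smul, smul_eq_mul, pow_add_apply]
        by_cases hkm : n - 1 ≤ k + m
        · rw [hu2 k hkm hk', hz _ (by omega)]; ring
        · have : k = n - 1 - (m+1) := by omega
          subst this
          rw [show n - 1 - (m+1) + (m+1) = n - 1 by omega, ← hcdef, ← hd]
          field_simp
          ring
  obtain ⟨u, hu, hu1, hu2⟩ := key n
  refine ⟨(φ ((N ^ (n-1)) u))⁻¹ • u, U.smul_mem _ hu, ?_, ?_⟩
  · simp only [map_smul, smul_eq_mul]; field_simp
  · intro k hk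
    simp only [map_smul, smul_eq_mul]
    rw [hu2 k (by omega) hk]; simp


/-- The Gram matrix is monomial with entries `±1`. -/
def Mono {κ : Type} (B : V →ₗ[ℝ] V →ₗ[ℝ] ℝ) (u : κ → V) : Prop :=
  ∀ x, ∃ y, (B (u x) (u y) = 1 ∨ B (u x) (u y) = -1) ∧ ∀ z, z ≠ y → B (u x) (u z) = 0

lemma mono_zero {κ : Type} [Fintype κ] (B : V →ₗ[ℝ] V →ₗ[ℝ] ℝ) (hB : ∀ x y, B x y = - B y x)
    (u : κ → V) (hu : Mono B u) (c : κ → ℝ) (h : ∀ z, B (∑ x, c x • u x) (u z) = 0) :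
    ∀ x, c x = 0 := by
  intro x
  obtain ⟨y, hy, hy2⟩ := hu x
  obtain ⟨x', hx', hx2⟩ := hu y
  have hne : B (u x) (u y) ≠ 0 := by rcases hy with h | h <;> rw [h] <;> norm_num
  have hxx : x = x' := by
    by_contra hne'
    have := hx2 x hne'
    rw [hB, neg_eq_zero] at this
    exact hne this
  subst hxx
  have h1 := h y
  rw [map_sum, LinearMap.sum_apply, Finset.sum_eq_single x] at h1
  · simp only [map_smul, LinearMap.smul_apply, smul_eq_mul] at h1
    exact (mul_eq_zero.mp h1).resolve_right hne
  · intro z _ hz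
    simp only [map_smul, LinearMap.smul_apply, smul_eq_mul]
    rw [hB, hx2 z hz]; simp
  · intro h; exact absurd (Finset.mem_univ _) h

lemma mono_indep {κ : Type} [Fintype κ] (B : V →ₗ[ℝ] V →ₗ[ℝ] ℝ) (hB : ∀ x y, B x y = - B y x)
    (u : κ → V) (hu : Mono B u) : LinearIndependent ℝ u := by
  rw [Fintype.linearIndependent_iff]
  intro c hc
  exact mono_zero B hB u hu c (fun z => by rw [hc]; simp)

lemma mono_nondeg {κ : Type} [Fintype κ] (B : V →ₗ[ℝ] V →ₗ[ℝ] ℝ) (hB : ∀ x y, B x y = - B y x)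
    (u : κ → V) (hu : Mono B u) (w : V) (hw : w ∈ Submodule.span ℝ (Set.range u))
    (h : ∀ z, B w (u z) = 0) : w = 0 := by
  rw [Submodule.mem_span_range_iff_exists_fun] at hw
  obtain ⟨c, rfl⟩ := hw
  have := mono_zero B hB u hu c h
  simp [this]

variable {ι : Type} [Fintype ι] [DecidableEq ι] {n : ι → ℕ}

/-- chain vectors -/
def ch (T : Module.End ℝ V) (lam : ι → ℝ) (f : ι → V) (x : Σ i, Fin (n i)) : V :=
  (NN T (lam x.1) ^ (x.2 : ℕ)) (f x.1)

/-- chain vectors on a subset of the blocks -/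
def chs (n : ι → ℕ) (T : Module.End ℝ V) (lam : ι → ℝ) (f : ι → V) (t : Finset ι)
    (x : {x : Σ i, Fin (n i) // x.1 ∈ t}) : V := ch T lam f x.1

lemma mono_of (B : V →ₗ[ℝ] V →ₗ[ℝ] ℝ) (T : Module.End ℝ V) (lam : ι → ℝ) (f : ι → V) (t : Finset ι)
    (H : ∀ i ∈ t, ∀ a < n i, ∃ j ∈ t, ∃ b < n j,
      (B ((NN T (lam i) ^ a) (f i)) ((NN T (lam j) ^ b) (f j)) = 1 ∨
        B ((NN T (lam i) ^ a) (f i)) ((NN T (lam j) ^ b) (f j)) = -1) ∧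
      ∀ j' ∈ t, ∀ b' < n j', ¬ (j' = j ∧ b' = b) →
        B ((NN T (lam i) ^ a) (f i)) ((NN T (lam j') ^ b') (f j')) = 0) :
    Mono B (chs n T lam f t) := by
  rintro ⟨⟨i, a⟩, hi⟩
  obtain ⟨j, hj, b, hb, h1, h2⟩ := H i hi a a.2
  refine ⟨⟨⟨j, ⟨b, hb⟩⟩, hj⟩, h1, ?_⟩
  rintro ⟨⟨j', b'⟩, hj'⟩ hne
  refine h2 j' hj' b' b'.2 ?_
  rintro ⟨rfl, h⟩
  apply hne
  congr 2
  exact Fin.ext h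

lemma chs_inv (T : Module.End ℝ V) (lam : ι → ℝ) (v : ι → V) (t : Finset ι)
    (hv : ∀ i ∈ t, (NN T (lam i) ^ n i) (v i) = 0) (x : V)
    (hx : x ∈ Submodule.span ℝ (Set.range (chs n T lam v t))) :
    T x ∈ Submodule.span ℝ (Set.range (chs n T lam v t)) := by
  induction hx using Submodule.span_induction with
  | mem x h =>
    obtain ⟨⟨⟨i, a⟩, hi⟩, rfl⟩ := h
    have e : T (chs n T lam v t ⟨⟨i, a⟩, hi⟩) = lam i • chs n T lam v t ⟨⟨i, a⟩, hi⟩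
        + (NN T (lam i) ^ ((a : ℕ) + 1)) (v i) := by
      rw [pow_succ', Module.End.mul_apply, NN_apply]
      simp [chs, ch]
    rw [e]
    refine Submodule.add_mem _ (Submodule.smul_mem _ _ (Submodule.subset_span ⟨_, rfl⟩)) ?_
    by_cases h : (a : ℕ) + 1 < n i
    · exact Submodule.subset_span ⟨⟨⟨i, ⟨a + 1, h⟩⟩, hi⟩, rfl⟩
    · rw [pow_ge_zero _ (hv i hi) (by omega)]
      exact Submodule.zero_mem _
  | zero => simp
  | add x y _ _ hx hy => rw [map_add]; exact Submodule.add_mem _ hx hy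
  | smul c x _ hx => rw [map_smul]; exact Submodule.smul_mem _ _ hx

lemma NN_inv (T : Module.End ℝ V) (μ : ℝ) (U : Submodule ℝ V) (hU : ∀ x ∈ U, T x ∈ U) :
    ∀ x ∈ U, NN T μ x ∈ U := by
  intro x hx
  rw [NN_apply]
  exact U.sub_mem (hU x hx) (U.smul_mem _ hx)

lemma mem_chs (hn : ∀ i, 1 ≤ n i) (T : Module.End ℝ V) (lam : ι → ℝ) (v : ι → V) (t : Finset ι)
    (i : ι) (hi : i ∈ t) : v i ∈ Submodule.span ℝ (Set.range (chs n T lam v t)) :=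
  Submodule.subset_span ⟨⟨⟨i, ⟨0, hn i⟩⟩, hi⟩, by simp [chs, ch]⟩

lemma find_pair [FiniteDimensional ℝ V] (hn : ∀ i, 1 ≤ n i) (lam : ι → ℝ) (s : Finset ι)
    (hs : s.Nonempty)
    (T : Module.End ℝ V) (B : V →ₗ[ℝ] V →ₗ[ℝ] ℝ)
    (hnd : ∀ x, (∀ y, B x y = 0) → x = 0) (hT : ∀ x y, B (T x) y = - B x (T y))
    (v : ι → V) (hv : ∀ i ∈ s, (NN T (lam i) ^ n i) (v i) = 0)
    (hspan : ⊤ ≤ Submodule.span ℝ (Set.range (chs n T lam v s)))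
    (hdim : Fintype.card {x : Σ i, Fin (n i) // x.1 ∈ s} ≤ Module.finrank ℝ V) :
    ∃ i ∈ s, ∃ j ∈ s, n j = n i ∧ lam i + lam j = 0 ∧
      B (v i) ((NN T (lam j) ^ (n i - 1)) (v j)) ≠ 0 := by
  have hli : LinearIndependent ℝ (chs n T lam v s) := by
    apply linearIndependent_of_top_le_span_of_card_eq_finrank hspan
    apply le_antisymm hdim
    have := finrank_range_le_card (R := ℝ) (chs n T lam v s)
    rw [Set.finrank, top_le_iff.mp hspan, finrank_top] at this
    exact this
  obtain ⟨i, hi, hmax⟩ := Finset.exists_max_image s n hs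
  have hne : (NN T (lam i) ^ (n i - 1)) (v i) ≠ 0 :=
    LinearIndependent.ne_zero (v := chs n T lam v s)
      ⟨⟨i, ⟨n i - 1, by have := hn i; omega⟩⟩, hi⟩ hli
  have : ∃ j ∈ s, ∃ b < n j, B ((NN T (lam i) ^ (n i - 1)) (v i)) ((NN T (lam j) ^ b) (v j)) ≠ 0 := by
    by_contra hcon
    push Not at hcon
    apply hne
    apply hnd
    intro y
    have hy : y ∈ Submodule.span ℝ (Set.range (chs n T lam v s)) := hspan trivial
    induction hy using Submodule.span_induction with
    | mem x h =>
      obtain ⟨⟨⟨j, b⟩, hj⟩, rfl⟩ := h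
      exact hcon j hj b b.2
    | zero => simp
    | add x y _ _ hx hy => rw [map_add, hx, hy, add_zero]
    | smul c x _ hx => rw [map_smul, hx, smul_zero]
  obtain ⟨j, hj, b, hb, hB⟩ := this
  have hlam : lam i + lam j = 0 := by
    by_contra hc
    apply hB
    refine orth_of_ne B T hT _ _ hc _ (n i) (n j) rfl _ _ ?_ ?_
    · rw [pow_add_apply]; exact pow_ge_zero _ (hv i hi) (by omega)
    · rw [pow_add_apply]; exact pow_ge_zero _ (hv j hj) (by omega)
  rw [adj_pow B _ _ (NN_adj B T hT _ _ hlam), pow_add_apply] at hB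
  have hlt : n i - 1 + b < n j := by
    by_contra hc
    apply hB
    rw [pow_ge_zero _ (hv j hj) (by omega)]; simp
  have := hmax j hj
  have hb0 : b = 0 := by omega
  subst hb0
  exact ⟨i, hi, j, hj, by omega, hlam, fun h => hB (by rw [add_zero, h, mul_zero])⟩

lemma find_t [FiniteDimensional ℝ V] (hn : ∀ i, 1 ≤ n i) (lam : ι → ℝ) (s : Finset ι)
    (hs : s.Nonempty)
    (T : Module.End ℝ V) (B : V →ₗ[ℝ] V →ₗ[ℝ] ℝ) (hB : ∀ x y, B x y = - B y x)
    (hnd : ∀ x, (∀ y, B x y = 0) → x = 0) (hT : ∀ x y, B (T x) y = - B x (T y))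
    (v : ι → V) (hv : ∀ i ∈ s, (NN T (lam i) ^ n i) (v i) = 0)
    (hspan : ⊤ ≤ Submodule.span ℝ (Set.range (chs n T lam v s)))
    (hdim : Fintype.card {x : Σ i, Fin (n i) // x.1 ∈ s} ≤ Module.finrank ℝ V) :
    ∃ t ⊆ s, t.Nonempty ∧ ∃ f : ι → V, (∀ i ∈ t, (NN T (lam i) ^ n i) (f i) = 0) ∧
      (∀ i ∈ t, f i ∈ Submodule.span ℝ (Set.range (chs n T lam v t))) ∧
      Mono B (chs n T lam f t) := by
  by_cases hA : ∃ i ∈ s, lam i = 0 ∧ B (v i) ((NN T (lam i) ^ (n i - 1)) (v i)) ≠ 0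
  · obtain ⟨i, hi, hl, hc⟩ := hA
    have hvt : ∀ j ∈ ({i} : Finset ι), (NN T (lam j) ^ n j) (v j) = 0 := by
      intro j hj; rw [Finset.mem_singleton] at hj; subst hj; exact hv _ hi
    have hadj := NN_adj B T hT (lam i) (lam i) (by rw [hl]; simp)
    obtain ⟨u, hu, hu1, hu2⟩ := caseA B hB (NN T (lam i)) hadj (n i) (hn i)
      (Submodule.span ℝ (Set.range (chs n T lam v {i})) ⊓ LinearMap.ker (NN T (lam i) ^ n i))
      (by
        rintro x ⟨h1, h2⟩
        refine ⟨NN_inv T _ _ (chs_inv T lam v {i} hvt) x h1, ?_⟩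
        have h2' : (NN T (lam i) ^ n i) x = 0 := h2
        change (NN T (lam i) ^ n i) (NN T (lam i) x) = 0
        rw [← Module.End.mul_apply, ← pow_succ, pow_succ', Module.End.mul_apply, h2', map_zero])
      (fun x hx => hx.2) (v i)
      ⟨mem_chs hn T lam v {i} i (by simp), hv i hi⟩ hc
    refine ⟨{i}, by simpa using hi, by simp, fun _ => u, ?_, ?_, ?_⟩
    · intro j hj; rw [Finset.mem_singleton] at hj; subst hj; exact hu.2
    · intro j hj; exact hu.1
    · apply mono_of
      intro j hj a ha
      rw [Finset.mem_singleton] at hj; subst hj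
      refine ⟨j, by simp, n j - 1 - a, by omega, ?_, ?_⟩
      · rw [adj_pow B _ _ hadj, pow_add_apply, show a + (n j - 1 - a) = n j - 1 by omega]
        rcases neg_one_pow_eq_or ℝ a with h | h <;> rcases hu1 with h' | h' <;> rw [h, h'] <;> simp
      · intro j' hj' b' hb' hne
        rw [Finset.mem_singleton] at hj'; subst hj'
        rw [adj_pow B _ _ hadj, pow_add_apply, hu2 _ ?_, mul_zero]
        intro hh
        exact hne ⟨rfl, by omega⟩
  · push Not at hA
    obtain ⟨i, hi, j, hj, hnj, hl, hc⟩ := find_pair hn lam s hs T B hnd hT v hv hspan hdim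
    have hij : i ≠ j := by
      rintro rfl
      exact hc (hA i hi (by linarith))
    have hts : ({i, j} : Finset ι) ⊆ s := by
      intro k hk; simp only [Finset.mem_insert, Finset.mem_singleton] at hk
      rcases hk with rfl | rfl <;> assumption
    have hvt : ∀ k ∈ ({i, j} : Finset ι), (NN T (lam k) ^ n k) (v k) = 0 := fun k hk => hv k (hts hk)
    set Ut := Submodule.span ℝ (Set.range (chs n T lam v {i, j})) with hUt
    have hvi : v i ∈ Ut := mem_chs hn T lam v {i, j} i (by simp)
    have hvj : v j ∈ Ut := mem_chs hn T lam v {i, j} j (by simp)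
    have hUinv : ∀ μ, ∀ x ∈ Ut, NN T μ x ∈ Ut := fun μ => NN_inv T μ Ut (chs_inv T lam v {i, j} hvt)
    have hadj := NN_adj B T hT (lam i) (lam j) hl
    obtain ⟨x, hx, y, hy, hx0, hy0, hxy, hxx, hyy⟩ : ∃ x ∈ Ut, ∃ y ∈ Ut,
        (NN T (lam i) ^ n i) x = 0 ∧ (NN T (lam j) ^ n i) y = 0 ∧
        B x ((NN T (lam j) ^ (n i - 1)) y) ≠ 0 ∧
        (∀ a b, B ((NN T (lam i) ^ a) x) ((NN T (lam i) ^ b) x) = 0) ∧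
        (∀ a b, B ((NN T (lam j) ^ a) y) ((NN T (lam j) ^ b) y) = 0) := by
      by_cases hli : lam i = 0
      · have hlj : lam j = lam i := by linarith
        rw [hlj] at hadj hc ⊢
        have hU1 : ∀ x ∈ Ut ⊓ LinearMap.ker (NN T (lam i) ^ n i), NN T (lam i) x ∈
            Ut ⊓ LinearMap.ker (NN T (lam i) ^ n i) := by
          rintro x ⟨h1, h2⟩
          refine ⟨hUinv _ x h1, ?_⟩
          have h2' : (NN T (lam i) ^ n i) x = 0 := h2
          change (NN T (lam i) ^ n i) (NN T (lam i) x) = 0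
          rw [← Module.End.mul_apply, ← pow_succ, pow_succ', Module.End.mul_apply, h2', map_zero]
        have hvj0 := hv j hj
        have hAj := hA j hj (by linarith)
        rw [hlj, hnj] at hvj0 hAj
        obtain ⟨x, hx, hx1, hx2⟩ := caseB1 B hB (NN T (lam i)) hadj (n i) (hn i) _ hU1
          (fun x hx => hx.2) (v i) (v j) ⟨hvi, hv i hi⟩ ⟨hvj, hvj0⟩ hc (hA i hi hli)
        have hsw : ∀ x y k, B x ((NN T (lam i) ^ k) y) ≠ 0 → B y ((NN T (lam i) ^ k) x) ≠ 0 := by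
          intro x y k h h'
          apply h
          rw [hB, adj_pow B _ _ hadj, h', mul_zero, neg_zero]
        obtain ⟨y, hy, hy1, hy2⟩ := caseB1 B hB (NN T (lam i)) hadj (n i) (hn i) _ hU1
          (fun x hx => hx.2) (v j) x ⟨hvj, hvj0⟩ hx (hsw _ _ _ hx1) hAj
        refine ⟨x, hx.1, y, hy.1, hx.2, hy.2, hsw _ _ _ hy1, ?_, ?_⟩
        · intro a b; rw [adj_pow B _ _ hadj, pow_add_apply, hx2, mul_zero]
        · intro a b; rw [adj_pow B _ _ hadj, pow_add_apply, hy2, mul_zero]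
      · have hz : ∀ k ∈ s, lam k ≠ 0 → ∀ a b, B ((NN T (lam k) ^ a) (v k)) ((NN T (lam k) ^ b) (v k)) = 0 := by
          intro k hk hk0 a b
          refine orth_of_ne B T hT (lam k) (lam k) ?_ _ (n k) (n k) rfl _ _ ?_ ?_
          · intro h; apply hk0; linarith
          · rw [pow_add_apply]; exact pow_ge_zero _ (hv k hk) (by omega)
          · rw [pow_add_apply]; exact pow_ge_zero _ (hv k hk) (by omega)
        refine ⟨v i, hvi, v j, hvj, hv i hi, hnj ▸ hv j hj, hc, hz i hi hli, hz j hj ?_⟩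
        intro h; apply hli; linarith
    set N := NN T (lam j) with hN
    set U2 := Submodule.span ℝ (Set.range fun k : ℕ => (N ^ k) y) with hU2
    have hU2inv : ∀ z ∈ U2, N z ∈ U2 := by
      intro z hz
      induction hz using Submodule.span_induction with
      | mem z h =>
        obtain ⟨k, rfl⟩ := h
        refine Submodule.subset_span ⟨k + 1, ?_⟩
        simp only [pow_succ', Module.End.mul_apply]
      | zero => simp
      | add x y _ _ hx hy => rw [map_add]; exact Submodule.add_mem _ hx hy
      | smul c x _ hx => rw [map_smul]; exact Submodule.smul_mem _ _ hx
    have hU2U : U2 ≤ Ut := by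
      rw [hU2, Submodule.span_le]
      rintro _ ⟨k, rfl⟩
      exact pow_mem_inv N Ut (hUinv _) k hy
    have hU20 : U2 ≤ LinearMap.ker (N ^ n i) := by
      rw [hU2, Submodule.span_le]
      rintro _ ⟨k, rfl⟩
      change (N ^ n i) ((N ^ k) y) = 0
      rw [pow_add_apply]; exact pow_ge_zero _ hy0 (by omega)
    have hiso : ∀ z ∈ U2, ∀ w ∈ U2, B z w = 0 := by
      intro z hz w hw
      induction hz using Submodule.span_induction with
      | mem z h =>
        obtain ⟨k, rfl⟩ := h
        induction hw using Submodule.span_induction with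
        | mem w h =>
          obtain ⟨l, rfl⟩ := h
          exact hyy k l
        | zero => simp
        | add x y _ _ hx hy => rw [map_add, hx, hy, add_zero]
        | smul c x _ hx => rw [map_smul, hx, smul_zero]
      | zero => simp
      | add x y _ _ hx hy => rw [map_add, LinearMap.add_apply, hx, hy, add_zero]
      | smul c x _ hx => rw [map_smul, LinearMap.smul_apply, hx, smul_zero]
    obtain ⟨y', hy', hy1, hy2⟩ := caseB2 (B x) N (n i) (hn i) U2 hU2inv (fun z hz => hU20 hz) y
      (Submodule.subset_span ⟨0, by simp⟩) hxy
    have hyy' : ∀ a b, B ((N ^ a) y') ((N ^ b) y') = 0 := fun a b =>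
      hiso _ (pow_mem_inv N U2 hU2inv a hy') _ (pow_mem_inv N U2 hU2inv b hy')
    have hG : ∀ a b, B ((NN T (lam i) ^ a) x) ((N ^ b) y') = (-1) ^ a * B x ((N ^ (a + b)) y') := by
      intro a b; rw [adj_pow B _ _ hadj, pow_add_apply]
    refine ⟨{i, j}, hts, by simp, fun k => if k = i then x else y', ?_, ?_, ?_⟩
    · intro k hk
      simp only [Finset.mem_insert, Finset.mem_singleton] at hk
      rcases hk with rfl | rfl
      · simpa using hx0
      · simp only [if_neg hij.symm]; rw [hnj]; exact hU20 hy'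
    · intro k hk
      dsimp only
      split_ifs
      · exact hx
      · exact hU2U hy'
    · apply mono_of
      intro k hk a ha
      simp only [Finset.mem_insert, Finset.mem_singleton] at hk
      rcases hk with rfl | rfl
      · refine ⟨j, by simp, n k - 1 - a, by omega, ?_, ?_⟩
        · simp only [if_true, if_neg hij.symm]
          rw [hG, show a + (n k - 1 - a) = n k - 1 by omega, hy1, mul_one]
          exact neg_one_pow_eq_or ℝ a
        · intro k' hk' b hb hne
          simp only [Finset.mem_insert, Finset.mem_singleton] at hk'
          rcases hk' with rfl | rfl
          · simp only [if_true]; exact hxx a b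
          · simp only [if_true, if_neg hij.symm]
            rw [hG, hy2 _ (fun h => hne ⟨rfl, by omega⟩), mul_zero]
      · refine ⟨i, by simp, n i - 1 - a, by omega, ?_, ?_⟩
        · simp only [if_true, if_neg hij.symm]
          rw [hB, hG, show n i - 1 - a + a = n i - 1 by omega, hy1, mul_one]
          rcases neg_one_pow_eq_or ℝ (n i - 1 - a) with h | h <;> rw [h] <;> simp
        · intro k' hk' b hb hne
          simp only [Finset.mem_insert, Finset.mem_singleton] at hk'
          rcases hk' with rfl | rfl
          · simp only [if_true, if_neg hij.symm]
            rw [hB, hG, hy2 _ (fun h => hne ⟨rfl, by omega⟩), mul_zero, neg_zero]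
          · simp only [if_neg hij.symm]; exact hyy' a b

end aux

section aux2
variable {ι : Type} [Fintype ι] [DecidableEq ι] {n : ι → ℕ}

lemma intertw {V W : Type} [AddCommGroup V] [Module ℝ V] [AddCommGroup W] [Module ℝ W]
    (T : Module.End ℝ V) (T' : Module.End ℝ W) (q : V →ₗ[ℝ] W) (h : ∀ x, q (T x) = T' (q x))
    (μ : ℝ) (k : ℕ) (x : V) : q ((NN T μ ^ k) x) = (NN T' μ ^ k) (q x) := by
  induction k with
  | zero => simp
  | succ k ih =>
    rw [pow_succ', pow_succ', Module.End.mul_apply, Module.End.mul_apply, ← ih, NN_apply, NN_apply,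
      map_sub, map_smul, h]

theorem main_ind (hn : ∀ i, 1 ≤ n i) (lam : ι → ℝ) (s : Finset ι) :
    ∀ (V : Type) [AddCommGroup V] [Module ℝ V] [FiniteDimensional ℝ V]
    (T : Module.End ℝ V) (B : V →ₗ[ℝ] V →ₗ[ℝ] ℝ) (_ : ∀ x y, B x y = - B y x)
    (_ : ∀ x, (∀ y, B x y = 0) → x = 0) (_ : ∀ x y, B (T x) y = - B x (T y))
    (v : ι → V) (_ : ∀ i ∈ s, (NN T (lam i) ^ n i) (v i) = 0)
    (_ : ⊤ ≤ Submodule.span ℝ (Set.range (chs n T lam v s)))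
    (_ : Fintype.card {x : Σ i, Fin (n i) // x.1 ∈ s} ≤ Module.finrank ℝ V),
    ∃ f : ι → V, (∀ i ∈ s, (NN T (lam i) ^ n i) (f i) = 0) ∧ Mono B (chs n T lam f s) := by
  induction s using Finset.strongInduction with
  | H s ih =>
  intro V _ _ _ T B hB hnd hT v hv hspan hdim
  rcases s.eq_empty_or_nonempty with rfl | hs
  · exact ⟨v, hv, fun x => absurd x.2 (by simp)⟩
  obtain ⟨t, hts, htne, f, hf, hfU, hmono⟩ := find_t hn lam s hs T B hB hnd hT v hv hspan hdim
  set W := Submodule.span ℝ (Set.range (chs n T lam f t)) with hW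
  have hTv := chs_inv (n := n) T lam v t (fun i hi => hv i (hts hi))
  have hWU : W = Submodule.span ℝ (Set.range (chs n T lam v t)) := by
    apply Submodule.eq_of_le_of_finrank_le
    · rw [hW, Submodule.span_le]
      rintro _ ⟨⟨⟨i, a⟩, hi⟩, rfl⟩
      exact pow_mem_inv _ _ (NN_inv T _ _ hTv) _ (hfU i hi)
    · rw [hW, finrank_span_eq_card (mono_indep B hB _ hmono)]
      exact finrank_range_le_card (R := ℝ) (chs n T lam v t)
  have hTW : ∀ x ∈ W, T x ∈ W := by rw [hWU]; exact hTv
  have hrefl : LinearMap.BilinForm.IsRefl B := fun x y h => by rw [hB, h, neg_zero]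
  have hcompl : IsCompl W (LinearMap.BilinForm.orthogonal B W) := by
    rw [LinearMap.BilinForm.isCompl_orthogonal_iff_disjoint hrefl, Submodule.disjoint_def]
    intro x hx hx'
    refine mono_nondeg B hB _ hmono x hx (fun z => ?_)
    have := hx' (chs n T lam f t z) (Submodule.subset_span ⟨z, rfl⟩)
    rw [hB, this, neg_zero]
  set W' := LinearMap.BilinForm.orthogonal B W with hW'
  have horth : ∀ x ∈ W, ∀ y ∈ W', B x y = 0 := fun x hx y hy => hy x hx
  have horth' : ∀ x ∈ W, ∀ y ∈ W', B y x = 0 := fun x hx y hy => by rw [hB, hy x hx, neg_zero]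
  have hTW' : ∀ x ∈ W', T x ∈ W' := by
    intro x hx w hw
    have : B (T w) x = 0 := hx _ (hTW w hw)
    rw [hT] at this
    change B w (T x) = 0
    linarith
  have hdec : ∀ x : V, ∃ w ∈ W, ∃ w' ∈ W', w + w' = x := fun x =>
    Submodule.mem_sup.mp (by rw [hcompl.sup_eq_top]; trivial)
  set q := Submodule.projectionOnto W' W hcompl.symm with hq
  set T' : Module.End ℝ W' := T.restrict hTW' with hT'
  set B' : W' →ₗ[ℝ] W' →ₗ[ℝ] ℝ := LinearMap.BilinForm.restrict B W' with hB'
  have hqW : ∀ w ∈ W, q w = 0 := fun w hw =>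
    (Submodule.projectionOnto_apply_eq_zero_iff hcompl.symm).mpr hw
  have hqW' : ∀ w (h : w ∈ W'), q w = ⟨w, h⟩ := fun w h =>
    Submodule.projectionOnto_apply_of_mem_left hcompl.symm h
  have hqT : ∀ x, q (T x) = T' (q x) := by
    intro x
    obtain ⟨w, hw, w', hw', rfl⟩ := hdec x
    rw [map_add, map_add, map_add, hqW _ (hTW _ hw), hqW _ hw, hqW' _ (hTW' _ hw'), hqW' _ hw']
    simp only [zero_add]
    rfl
  have hBB' : ∀ x y : W', B' x y = B x y := fun x y => rfl
  have hcard : Fintype.card {x : Σ i, Fin (n i) // x.1 ∈ s}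
      = Fintype.card {x : Σ i, Fin (n i) // x.1 ∈ t} + Fintype.card {x : Σ i, Fin (n i) // x.1 ∈ s \ t} := by
    rw [← Fintype.card_subtype_or_disjoint]
    · apply Fintype.card_congr
      apply Equiv.subtypeEquivRight
      intro x
      rw [Finset.mem_sdiff]
      constructor
      · intro h; by_cases h' : x.1 ∈ t
        · exact Or.inl h'
        · exact Or.inr ⟨h, h'⟩
      · rintro (h | h)
        · exact hts h
        · exact h.1
    · rw [Pi.disjoint_iff]
      intro x
      rw [Prop.disjoint_iff, Finset.mem_sdiff]
      tauto
  obtain ⟨f', hf', hmono'⟩ := ih (s \ t) (Finset.sdiff_ssubset hts htne) W' T' B'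
    (fun x y => hB x y)
    (by
      intro x hx
      apply Subtype.ext
      apply hnd
      intro y
      obtain ⟨w, hw, w', hw', rfl⟩ := hdec y
      rw [map_add, horth' _ hw _ x.2, zero_add]
      exact hx ⟨w', hw'⟩)
    (fun x y => hT x y)
    (fun i => q (v i))
    (by
      intro i hi
      rw [← intertw T T' q hqT, hv i (Finset.mem_sdiff.mp hi).1, map_zero])
    (by
      have h1 : (⊤ : Submodule ℝ W') = Submodule.map q ⊤ := by
        rw [Submodule.map_top, hq, Submodule.range_projectionOnto]
      rw [h1, ← top_le_iff.mp hspan, Submodule.map_span, Submodule.span_le]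
      rintro _ ⟨_, ⟨⟨⟨i, a⟩, hi⟩, rfl⟩, rfl⟩
      by_cases hit : i ∈ t
      · have : chs n T lam v s ⟨⟨i, a⟩, hi⟩ ∈ W := by
          rw [hWU]
          exact Submodule.subset_span ⟨⟨⟨i, a⟩, hit⟩, rfl⟩
        rw [hqW _ this]
        exact Submodule.zero_mem _
      · refine Submodule.subset_span ⟨⟨⟨i, a⟩, Finset.mem_sdiff.mpr ⟨hi, hit⟩⟩, ?_⟩
        simp only [chs, ch]
        rw [intertw T T' q hqT])
    (by
      have h1 := Submodule.finrank_add_eq_of_isCompl hcompl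
      have h2 : Module.finrank ℝ W = Fintype.card {x : Σ i, Fin (n i) // x.1 ∈ t} :=
        finrank_span_eq_card (mono_indep B hB _ hmono)
      omega)
  have hcoe : ∀ μ k (x : W'), ((NN T' μ ^ k) x : V) = (NN T μ ^ k) (x : V) := fun μ k x =>
    intertw T' T W'.subtype (fun x => rfl) μ k x
  set g : ι → V := fun i => if i ∈ t then f i else (f' i : V) with hg
  have hgt : ∀ x : Σ i, Fin (n i), x.1 ∈ t → ch T lam g x = ch T lam f x := by
    intro x hx; simp only [ch, hg, if_pos hx]
  have hgt' : ∀ x : Σ i, Fin (n i), x.1 ∉ t → ch T lam g x = (ch T' lam f' x : W') := by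
    intro x hx; simp only [ch, hg, if_neg hx, hcoe]
  have hWm : ∀ x : Σ i, Fin (n i), x.1 ∈ t → ch T lam f x ∈ W := fun x hx =>
    Submodule.subset_span ⟨⟨x, hx⟩, rfl⟩
  refine ⟨g, ?_, ?_⟩
  · intro i hi
    by_cases hit : i ∈ t
    · simp only [hg, if_pos hit]; exact hf i hit
    · simp only [hg, if_neg hit]
      rw [← hcoe, hf' i (Finset.mem_sdiff.mpr ⟨hi, hit⟩)]; rfl
  · rintro ⟨x, hx⟩
    by_cases hxt : x.1 ∈ t
    · obtain ⟨⟨y, hy⟩, h1, h2⟩ := hmono ⟨x, hxt⟩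
      refine ⟨⟨y, hts hy⟩, ?_, ?_⟩
      · simp only [chs] at h1 ⊢
        rw [hgt x hxt, hgt y hy]; exact h1
      · rintro ⟨z, hz⟩ hne
        simp only [chs]
        rw [hgt x hxt]
        by_cases hzt : z.1 ∈ t
        · rw [hgt z hzt]
          exact h2 ⟨z, hzt⟩ (fun h => hne (by simpa using h))
        · rw [hgt' z hzt]
          exact horth _ (hWm x hxt) _ (Subtype.mem _)
    · obtain ⟨⟨y, hy⟩, h1, h2⟩ := hmono' ⟨x, Finset.mem_sdiff.mpr ⟨hx, hxt⟩⟩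
      have hy' := Finset.mem_sdiff.mp hy
      refine ⟨⟨y, hy'.1⟩, ?_, ?_⟩
      · simp only [chs] at h1 ⊢
        rw [hgt' x hxt, hgt' y hy'.2]; exact h1
      · rintro ⟨z, hz⟩ hne
        simp only [chs]
        rw [hgt' x hxt]
        by_cases hzt : z.1 ∈ t
        · rw [hgt z hzt]
          exact horth' _ (hWm z hzt) _ (Subtype.mem _)
        · rw [hgt' z hzt]
          exact h2 ⟨z, Finset.mem_sdiff.mpr ⟨hz, hzt⟩⟩ (fun h => hne (by simpa using h))

/-- entries of `canonJ` -/
def cj (r a b : ℕ) : ℝ :=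
  if a < r ∧ b = a + r then 1 else if b < r ∧ a = b + r then -1 else 0

lemma canonJ_cj (N R : ℕ) (i j : Fin N) : canonJ N R i j = cj (R / 2) i j := rfl

lemma monomial_canon {κ : Type} [Fintype κ] [DecidableEq κ] (G : Matrix κ κ ℝ)
    (hG : ∀ x y, G x y = - G y x)
    (hm : ∀ x, ∃ y, (G x y = 1 ∨ G x y = -1) ∧ ∀ z, z ≠ y → G x z = 0)
    (N : ℕ) (hN : Fintype.card κ = N) :
    ∃ e : κ ≃ Fin N, Matrix.reindex e e G = canonJ N N := by
  classical
  choose ρ h1 h2 using hm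
  have hne : ∀ x, G x (ρ x) ≠ 0 := fun x => by rcases h1 x with h | h <;> rw [h] <;> norm_num
  have huniq : ∀ x y, G x y ≠ 0 → y = ρ x := fun x y h => by
    by_contra hc; exact h (h2 x y hc)
  have hinv : ∀ x, ρ (ρ x) = x := fun x =>
    (huniq _ _ (by rw [hG]; exact neg_ne_zero.mpr (hne x))).symm
  set r := Fintype.card {x // G x (ρ x) = 1} with hr
  let e0 : Fin r ≃ {x // G x (ρ x) = 1} := (Fintype.equivFin _).symm
  have hswap : ∀ x, G (ρ x) (ρ (ρ x)) = - G x (ρ x) := fun x => by rw [hinv, hG]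
  let g : Fin r ⊕ Fin r → κ := Sum.elim (fun a => (e0 a : κ)) (fun a => ρ (e0 a : κ))
  have hρinj : Function.Injective ρ := fun x y h => by rw [← hinv x, h, hinv]
  have hlr : ∀ a b, (e0 a : κ) ≠ ρ (e0 b : κ) := by
    intro a b h
    have ha := (e0 a).2
    have hb := (e0 b).2
    rw [h, hswap, hb] at ha
    norm_num at ha
  have hg : Function.Bijective g := by
    constructor
    · rintro (a | a) (b | b) h
      · exact congrArg Sum.inl (e0.injective (Subtype.ext h))
      · exact absurd h (hlr a b)
      · exact absurd h.symm (hlr b a)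
      · exact congrArg Sum.inr (e0.injective (Subtype.ext (hρinj h)))
    · intro x
      rcases h1 x with h | h
      · exact ⟨Sum.inl (e0.symm ⟨x, h⟩), by simp [g]⟩
      · exact ⟨Sum.inr (e0.symm ⟨ρ x, by rw [hswap, h]; norm_num⟩), by simp [g, hinv]⟩
  let E : Fin r ⊕ Fin r ≃ κ := Equiv.ofBijective g hg
  have hNr : N = r + r := by
    rw [← hN, ← Fintype.card_congr E]; simp
  subst hNr
  refine ⟨E.symm.trans finSumFinEquiv, ?_⟩
  have hll : ∀ a b, G (e0 a) (e0 b) = 0 := fun a b => h2 _ _ (hlr b a)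
  have hlr2 : ∀ a b, G (e0 a) (ρ (e0 b)) = if a = b then 1 else 0 := by
    intro a b
    split_ifs with h
    · subst h; exact (e0 a).2
    · apply h2; intro h'; exact h (e0.injective (Subtype.ext (hρinj h'))).symm
  ext i j
  obtain ⟨i, rfl⟩ := finSumFinEquiv.surjective i
  obtain ⟨j, rfl⟩ := finSumFinEquiv.surjective j
  have hrr : (r + r) / 2 = r := by omega
  have hE : ∀ i, E i = g i := fun i => rfl
  rw [canonJ_cj, hrr]
  simp only [Matrix.reindex_apply, Matrix.submatrix_apply, Equiv.symm_trans_apply, Equiv.symm_symm,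
    Equiv.symm_apply_apply, hE]
  rcases i with i | i <;> rcases j with j | j
  · simp only [g, Sum.elim_inl, hll, finSumFinEquiv_apply_left, Fin.val_castAdd]
    have := i.2; have := j.2
    rw [cj, if_neg (by omega), if_neg (by omega)]
  · simp only [g, Sum.elim_inl, Sum.elim_inr, hlr2, finSumFinEquiv_apply_left, Fin.val_castAdd,
      finSumFinEquiv_apply_right, Fin.val_natAdd, Fin.ext_iff]
    have := i.2; have := j.2
    rw [cj]
    split_ifs <;> first | rfl | omega
  · rw [hG]
    simp only [g, Sum.elim_inl, Sum.elim_inr, hlr2, finSumFinEquiv_apply_left, Fin.val_castAdd,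
      finSumFinEquiv_apply_right, Fin.val_natAdd, Fin.ext_iff]
    have := i.2; have := j.2
    rw [cj]
    split_ifs <;> first | rfl | omega | exact neg_zero
  · have : G (ρ (e0 i)) (ρ (e0 j)) = 0 := by
      apply h2; rw [hinv]; exact fun h => hlr i j h.symm
    simp only [g, Sum.elim_inr, this, finSumFinEquiv_apply_right, Fin.val_natAdd]
    rw [cj, if_neg (by omega), if_neg (by omega)]

lemma jordan_single (lam : ι → ℝ) (i : ι) (k : ℕ) (hk : k < n i) :
    (Matrix.blockDiagonal' (fun i => jordanBlock (n i) (lam i))) *ᵥ Pi.single ⟨i, ⟨k, hk⟩⟩ 1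
      = lam i • Pi.single ⟨i, ⟨k, hk⟩⟩ 1 +
        (if 0 < k then Pi.single ⟨i, ⟨k - 1, by omega⟩⟩ 1 else 0 : (Σ i, Fin (n i)) → ℝ) := by
  ext ⟨j, l⟩
  rw [Matrix.mulVec_single_one]
  simp only [Matrix.col_apply, Matrix.blockDiagonal'_apply, Pi.add_apply, Pi.smul_apply, smul_eq_mul]
  by_cases hji : j = i
  · subst hji
    simp only [jordanBlock, Matrix.of_apply, dif_pos, cast_eq]
    by_cases h0 : 0 < k
    · simp only [if_pos h0, Pi.single_apply, Sigma.mk.injEq, heq_eq_eq, true_and, Fin.ext_iff]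
      split_ifs <;> first | omega | simp
    · simp only [if_neg h0, Pi.single_apply, Sigma.mk.injEq, heq_eq_eq, true_and, Fin.ext_iff, Pi.zero_apply]
      split_ifs <;> first | omega | simp
  · rw [dif_neg hji]
    have h1 : ∀ m : Fin (n i), (Pi.single (⟨i, m⟩ : Σ i, Fin (n i)) (1 : ℝ) : (Σ i, Fin (n i)) → ℝ) ⟨j, l⟩ = 0 := by
      intro m
      rw [Pi.single_apply, if_neg]
      intro h
      exact hji (congrArg Sigma.fst h)
    split_ifs <;> simp [h1]

end aux2
/-- For an even-dimensional real-eigenvalue Jordan matrix `𝒥`, every invertible skew-symmetric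
solution of `B𝒥 + 𝒥ᵀB = 0` is congruent, via an invertible element of the commutant of `𝒥`,
to a permutation of the standard symplectic matrix. -/
theorem canonical_form_real_even
    (p : ℕ) (hp : 1 ≤ p) (n : Fin p → ℕ) (hn : ∀ i, 1 ≤ n i) (lam : Fin p → ℝ)
    (hN : Even (∑ i, n i))
    (B : Matrix (Σ i, Fin (n i)) (Σ i, Fin (n i)) ℝ)
    (hskew : Bᵀ = -B) (hinv : IsUnit B)
    (heq : B * Matrix.blockDiagonal' (fun i => jordanBlock (n i) (lam i))
        + (Matrix.blockDiagonal' (fun i => jordanBlock (n i) (lam i)))ᵀ * B = 0) :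
    ∃ A : Matrix (Σ i, Fin (n i)) (Σ i, Fin (n i)) ℝ, IsUnit A ∧
      A * Matrix.blockDiagonal' (fun i => jordanBlock (n i) (lam i))
        = Matrix.blockDiagonal' (fun i => jordanBlock (n i) (lam i)) * A ∧
      ∃ e : (Σ i, Fin (n i)) ≃ Fin (∑ i, n i),
        Matrix.reindex e e (Aᵀ * B * A) = canonJ (∑ i, n i) (∑ i, n i) := by
  classical
  set 𝒥 := Matrix.blockDiagonal' (fun i => jordanBlock (n i) (lam i)) with hJ
  let T : Module.End ℝ ((Σ i, Fin (n i)) → ℝ) := Matrix.mulVecLin 𝒥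
  let Bf : ((Σ i, Fin (n i)) → ℝ) →ₗ[ℝ] ((Σ i, Fin (n i)) → ℝ) →ₗ[ℝ] ℝ := Matrix.toLinearMap₂' ℝ B
  have hTa : ∀ x, T x = 𝒥 *ᵥ x := fun x => rfl
  have hBf : ∀ x y, Bf x y = x ⬝ᵥ (B *ᵥ y) := fun x y => Matrix.toLinearMap₂'_apply' B x y
  have hBs : ∀ x y, Bf x y = - Bf y x := by
    intro x y
    rw [hBf, hBf, Matrix.dotProduct_mulVec, ← Matrix.mulVec_transpose, hskew, Matrix.neg_mulVec,
      neg_dotProduct, dotProduct_comm]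
  have hBT : ∀ x y, Bf (T x) y = - Bf x (T y) := by
    intro x y
    have h1 : B * 𝒥 = - (𝒥ᵀ * B) := eq_neg_of_add_eq_zero_left heq
    rw [hBf, hBf, hTa, hTa, Matrix.mulVec_mulVec, h1, Matrix.neg_mulVec, dotProduct_neg, neg_neg,
      ← Matrix.mulVec_mulVec, Matrix.dotProduct_mulVec x, Matrix.vecMul_transpose]
  have hBn : ∀ x, (∀ y, Bf x y = 0) → x = 0 := by
    intro x hx
    have h1 : B *ᵥ x = 0 := by
      apply dotProduct_eq_zero
      intro y
      rw [dotProduct_comm, ← hBf, hBs, hx, neg_zero]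
    have := Matrix.mulVec_injective_iff_isUnit.mpr hinv
    exact this (by rw [h1, Matrix.mulVec_zero])
  let v : Fin p → ((Σ i, Fin (n i)) → ℝ) := fun i => Pi.single ⟨i, ⟨n i - 1, by have := hn i; omega⟩⟩ 1
  have hNs : ∀ i k (hk : k < n i), NN T (lam i) (Pi.single ⟨i, ⟨k, hk⟩⟩ 1)
      = (if 0 < k then Pi.single ⟨i, ⟨k - 1, by omega⟩⟩ 1 else 0 : (Σ i, Fin (n i)) → ℝ) := by
    intro i k hk
    rw [NN_apply, hTa, hJ, jordan_single, add_sub_cancel_left]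
  have hNv : ∀ i k (hk : k < n i), (NN T (lam i) ^ k) (v i) = Pi.single ⟨i, ⟨n i - 1 - k, by omega⟩⟩ 1 := by
    intro i k
    induction k with
    | zero => intro hk; rfl
    | succ k ih =>
      intro hk
      rw [pow_succ', Module.End.mul_apply, ih (by omega), hNs, if_pos (by omega)]
      congr 1
  have hNv0 : ∀ i, (NN T (lam i) ^ n i) (v i) = 0 := by
    intro i
    have := hn i
    obtain ⟨m, hm⟩ : ∃ m, n i = m + 1 := ⟨n i - 1, by omega⟩
    have h2 := hNv i m (by omega)
    have h3 := hNs i (n i - 1 - m) (by omega)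
    rw [if_neg (by omega), ← h2, ← Module.End.mul_apply, ← pow_succ'] at h3
    rw [hm]; exact h3
  obtain ⟨f, hf, hm⟩ := main_ind hn lam Finset.univ _ T Bf hBs hBn hBT v (fun i _ => hNv0 i)
    (by
      rw [← (Pi.basisFun ℝ (Σ i, Fin (n i))).span_eq, Submodule.span_le]
      rintro _ ⟨⟨i, k⟩, rfl⟩
      refine Submodule.subset_span ⟨⟨⟨i, ⟨n i - 1 - k, by have := k.2; omega⟩⟩, Finset.mem_univ _⟩, ?_⟩
      simp only [chs, ch]
      rw [hNv i _ (by have := k.2; omega), Pi.basisFun_apply]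
      congr 2
      apply Fin.ext
      have := k.2
      simp only
      omega)
    (by
      rw [Module.finrank_fintype_fun_eq_card]
      exact Fintype.card_subtype_le _)
  let u : (Σ i, Fin (n i)) → ((Σ i, Fin (n i)) → ℝ) := fun x => ch T lam f ⟨x.1, Fin.rev x.2⟩
  have hu : Mono Bf u := by
    rintro ⟨i, k⟩
    obtain ⟨⟨⟨j, l⟩, _⟩, h1, h2⟩ := hm ⟨⟨i, Fin.rev k⟩, Finset.mem_univ _⟩
    refine ⟨⟨j, Fin.rev l⟩, ?_, ?_⟩
    · simp only [u, Fin.rev_rev]; exact h1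
    · rintro ⟨j', l'⟩ hne
      refine h2 ⟨⟨j', Fin.rev l'⟩, Finset.mem_univ _⟩ ?_
      intro h
      apply hne
      simp only [Subtype.mk.injEq, Sigma.mk.injEq] at h
      obtain ⟨rfl, h⟩ := h
      rw [← eq_of_heq h, Fin.rev_rev]
  let A : Matrix (Σ i, Fin (n i)) (Σ i, Fin (n i)) ℝ := Matrix.of fun x y => u y x
  have hAcol : ∀ y, A *ᵥ Pi.single y 1 = u y := by
    intro y; rw [Matrix.mulVec_single_one]; rfl
  refine ⟨A, ?_, ?_, ?_⟩
  · rw [← Matrix.linearIndependent_cols_iff_isUnit]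
    exact mono_indep Bf hBs u hu
  · apply Matrix.ext_of_mulVec_single
    rintro ⟨i, k, hk⟩
    rw [← Matrix.mulVec_mulVec, ← Matrix.mulVec_mulVec, hAcol, hJ, jordan_single, ← hJ, ← hTa,
      Matrix.mulVec_add, Matrix.mulVec_smul, hAcol]
    have h1 : T (u ⟨i, ⟨k, hk⟩⟩) = lam i • u ⟨i, ⟨k, hk⟩⟩ + (NN T (lam i) ^ (n i - k)) (f i) := by
      have h2 : (NN T (lam i) ^ (n i - k)) (f i) = NN T (lam i) (u ⟨i, ⟨k, hk⟩⟩) := by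
        simp only [u, ch, Fin.val_rev]
        rw [← Module.End.mul_apply, ← pow_succ']
        congr 2
        omega
      rw [h2, NN_apply]; abel
    rw [h1]
    congr 1
    by_cases h0 : 0 < k
    · rw [if_pos h0, hAcol]
      simp only [u, ch, Fin.val_rev]
      congr 2
      omega
    · rw [if_neg h0, Matrix.mulVec_zero, show n i - k = n i by omega, hf i (Finset.mem_univ _)]
  · have hGe : ∀ x y, (Aᵀ * B * A) x y = Bf (u x) (u y) := by
      intro x y
      rw [hBf, Matrix.mul_assoc]
      rfl
    apply monomial_canon
    · intro x y; rw [hGe, hGe, hBs]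
    · intro x
      obtain ⟨y, h1, h2⟩ := hu x
      exact ⟨y, by rw [hGe]; exact h1, fun z hz => by rw [hGe]; exact h2 z hz⟩
    · simp
end
end
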